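/- arXiv:2601.01911 — 7 statements merged into one kernel-verified Lean document; each statement's English description precedes it below -/
import Mathlib

section
/- Let G be a finite simple graph with finite girth g, let C be a shortest cycle of G (so C has length g), and let x be a vertex not on C. Suppose there exist k paths in G from x to V(C), each of length l, which pairwise intersect only in x, whose internal vertices avoid C, and whose terminal vertices on C are k pairwise distinct vertices (a k-fan of length l from x to V(C)). Then ⌊g/k⌋ + 2l ≥ g. -/
lemma fan_append_isPath {V : Type} {G : SimpleGraph V} {u v w : V} {p : G.Walk u v}
    {q : G.Walk v w} (hp : p.IsPath) (hq : q.IsPath)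
    (h : ∀ a, a ∈ p.support → a ∈ q.support → a = v) : (p.append q).IsPath := by
  rw [SimpleGraph.Walk.isPath_def, SimpleGraph.Walk.support_append, List.nodup_append']
  have hq' := hq.support_nodup
  rw [← SimpleGraph.Walk.cons_tail_support, List.nodup_cons] at hq'
  refine ⟨hp.support_nodup, hq'.2, ?_⟩
  intro a ha ha'
  have := h a ha (List.mem_of_mem_tail ha')
  subst this
  exact hq'.1 ha'

lemma fan_arc {V : Type} {G : SimpleGraph V} (f : ℕ → V) (hf : ∀ n, G.Adj (f n) (f (n+1)))
    (n d : ℕ) : ∃ w : G.Walk (f n) (f (n+d)), w.length = d ∧ ∀ v ∈ w.support, ∃ m, v = f m := by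
  induction d with
  | zero => exact ⟨SimpleGraph.Walk.nil, rfl, by simp⟩
  | succ d ih =>
    obtain ⟨w, h1, h2⟩ := ih
    refine ⟨w.concat (hf (n+d)), by simp [h1], ?_⟩
    intro v hv
    rw [SimpleGraph.Walk.support_concat] at hv
    simp only [List.concat_eq_append, List.mem_append, List.mem_singleton] at hv
    rcases hv with h | h
    · exact h2 v h
    · exact ⟨n+d+1, h⟩

lemma fan_cycle {V : Type} {G : SimpleGraph V} {x s t : V} (S : V → Prop) (hx : ¬ S x)
    (p : G.Walk x s) (q : G.Walk x t) (a : G.Walk s t)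
    (hp : p.IsPath) (hq : q.IsPath) (ha : a.IsPath)
    (hs : S s)
    (haS : ∀ v ∈ a.support, S v)
    (hpS : ∀ v ∈ p.support, S v → v = s)
    (hqS : ∀ v ∈ q.support, S v → v = t)
    (hd : ∀ v, v ∈ p.support → v ∈ q.support → v = x) :
    G.girth ≤ a.length + (p.length + q.length) := by
  cases p with
  | nil => exact absurd hs hx
  | @cons _ y _ h p' =>
    rw [SimpleGraph.Walk.cons_isPath_iff] at hp
    have hxy : x ≠ y := h.ne
    have h1 : (a.append q.reverse).IsPath := by
      refine fan_append_isPath ha hq.reverse ?_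
      intro v hv hv'
      exact hqS v (by simpa using hv') (haS v hv)
    have h2 : (p'.append (a.append q.reverse)).IsPath := by
      refine fan_append_isPath hp.1 h1 ?_
      intro v hv hv'
      rw [SimpleGraph.Walk.mem_support_append_iff] at hv'
      rcases hv' with h' | h'
      · exact hpS v (by simp [hv]) (haS v h')
      · have := hd v (by simp [hv]) (by simpa using h')
        subst this
        exact absurd hv hp.2
    have h3 : (SimpleGraph.Walk.cons h (p'.append (a.append q.reverse))).IsCycle := by
      rw [SimpleGraph.Walk.cons_isCycle_iff]
      refine ⟨h2, ?_⟩
      rw [SimpleGraph.Walk.edges_append, SimpleGraph.Walk.edges_append]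
      intro he
      rcases List.mem_append.1 he with he | he
      · exact hp.2 (SimpleGraph.Walk.fst_mem_support_of_mem_edges _ he)
      rcases List.mem_append.1 he with he | he
      · exact hx (haS _ (SimpleGraph.Walk.fst_mem_support_of_mem_edges _ he))
      · have := SimpleGraph.Walk.snd_mem_support_of_mem_edges _ he
        exact hxy (hd y (by simp) (by simpa using this)).symm
    have := SimpleGraph.girth_le_length h3
    simp at this ⊢
    omega

/-- If there is a `k`-fan of length `l` from a vertex `x` off a shortest
cycle `C` (of length the girth `g`) to `V(C)`, then `⌊g/k⌋ + 2l ≥ g`. -/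
theorem stmt_0 {V : Type} [Fintype V] (G : SimpleGraph V)
    (g k l : ℕ) (hk : 1 ≤ k)
    (hgirth : G.girth = (g : ℕ∞))
    (v0 : V) (c : G.Walk v0 v0) (hc : c.IsCycle) (hlen : c.length = g)
    (x : V) (hx : x ∉ c.support)
    (t : Fin k → V) (htC : ∀ i, t i ∈ c.support)
    (htinj : Function.Injective t)
    (P : (i : Fin k) → G.Walk x (t i))
    (hPpath : ∀ i, (P i).IsPath)
    (hPlen : ∀ i, (P i).length = l)
    (hinternal : ∀ i, ∀ v ∈ (P i).support, v ∈ c.support → v = t i)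
    (hdisjoint : ∀ i j, i ≠ j → ∀ v, v ∈ (P i).support → v ∈ (P j).support → v = x) :
    g ≤ g / k + 2 * l := by
  classical
  have hg : G.girth = g := by exact_mod_cast hgirth
  have hg3 : 3 ≤ g := hlen ▸ hc.three_le_length
  rcases Nat.lt_or_ge k 2 with hk2 | hk2
  · obtain rfl : k = 1 := by omega
    simp
  set f : ℕ → V := fun n => c.getVert (n % g) with hfdef
  have hfS : ∀ n, f n ∈ c.support := fun n => c.getVert_mem_support _
  have hf : ∀ n, G.Adj (f n) (f (n+1)) := by
    intro n
    have hlt : n % g < g := Nat.mod_lt _ (by omega)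
    have hadj := c.adj_getVert_succ (i := n % g) (by omega)
    have : f (n+1) = c.getVert (n % g + 1) := by
      simp only [hfdef]
      rcases Nat.lt_or_ge (n % g + 1) g with h | h
      · rw [Nat.add_mod, Nat.mod_eq_of_lt (a := 1) (by omega), Nat.mod_eq_of_lt h]
      · have h' : n % g + 1 = g := by omega
        rw [Nat.add_mod, Nat.mod_eq_of_lt (a := 1) (by omega), h', Nat.mod_self]
        rw [← hlen]; simp
    rw [this]; exact hadj
  have hpos : ∀ i, ∃ n, f n = t i := by
    intro i
    obtain ⟨n, h1, h2⟩ := SimpleGraph.Walk.mem_support_iff_exists_getVert.1 (htC i)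
    rcases Nat.lt_or_ge n g with h | h
    · exact ⟨n, by simp only [hfdef]; rw [Nat.mod_eq_of_lt h, h1]⟩
    · have hn : n = c.length := by omega
      refine ⟨0, ?_⟩
      rw [← h1, hn]; simp [hfdef]
  choose p hp using hpos
  have hfmod : ∀ m n, m % g = n % g → f m = f n := by
    intro m n h; simp only [hfdef, h]
  -- main step: two terminals joined by an arc of length `d ≤ g / k`
  have key : ∀ i j d, i ≠ j → d ≤ g / k → f (p i + d) = t j → g ≤ g / k + 2 * l := by
    intro i j d hij hd hfd
    obtain ⟨w, hw1, hw2⟩ := fan_arc f hf (p i) d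
    have hle := fan_cycle (fun v => v ∈ c.support) hx (P i) (P j)
      ((w.copy (hp i) hfd).bypass) (hPpath i) (hPpath j)
      (SimpleGraph.Walk.bypass_isPath _) (htC i) ?_ (hinternal i) (hinternal j)
      (hdisjoint i j hij)
    · have h2 := (w.copy (hp i) hfd).length_bypass_le_length
      rw [SimpleGraph.Walk.length_copy] at h2
      rw [hPlen, hPlen] at hle
      omega
    · intro v hv
      have := (w.copy (hp i) hfd).support_bypass_subset_support hv
      rw [SimpleGraph.Walk.support_copy] at this
      obtain ⟨m, rfl⟩ := hw2 v this
      exact hfS m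
  have hmg : g / k < g := Nat.div_lt_self (by omega) (by omega)
  let F : Fin k × Fin (g / k + 1) → Fin g := fun z =>
    ⟨(p z.1 + z.2) % g, Nat.mod_lt _ (by omega)⟩
  have hcard : Fintype.card (Fin g) < Fintype.card (Fin k × Fin (g / k + 1)) := by
    simp only [Fintype.card_fin, Fintype.card_prod]
    exact Nat.lt_mul_div_succ g (by omega)
  obtain ⟨⟨i, a⟩, ⟨j, b⟩, hne, hFeq⟩ := Fintype.exists_ne_map_eq_of_card_lt F hcard
  have hmod : (p i + a) ≡ (p j + b) [MOD g] := by
    simpa [F, Nat.ModEq] using hFeq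
  have ha := a.2
  have hb := b.2
  have hij : i ≠ j := by
    rintro rfl
    have h1 : (a : ℕ) ≡ b [MOD g] := Nat.ModEq.add_left_cancel' _ hmod
    have h2 : (a : ℕ) = b := Nat.ModEq.eq_of_lt_of_lt h1 (by omega) (by omega)
    exact hne (by rw [Fin.ext h2])
  rcases le_total (a : ℕ) b with hab | hab
  · have h1 : p j + (b - a) ≡ p i [MOD g] := by
      apply Nat.ModEq.add_right_cancel' (a : ℕ)
      rw [show p j + ((b : ℕ) - a) + a = p j + b by omega]
      exact hmod.symm
    exact key j i (b - a) hij.symm (by omega) ((hfmod _ _ h1).trans (hp i))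
  · have h1 : p i + (a - b) ≡ p j [MOD g] := by
      apply Nat.ModEq.add_right_cancel' (b : ℕ)
      rw [show p i + ((a : ℕ) - b) + b = p i + a by omega]
      exact hmod
    exact key i j (a - b) hij (by omega) ((hfmod _ _ h1).trans (hp j))
end

section
/- Let Γ be a canonical signed unicyclic graph with girth g ≡ 1 or 3 (mod 4) whose unique cycle C has length g, and suppose Γ is not itself a cycle. Let v_1, …, v_k (k ≥ 1) be the major vertices of Γ listed in cyclic order along C, and let l_1, …, l_k ≥ 0 be the numbers of vertices on the k arcs of C strictly between consecutive major vertices, so that g = k + l_1 + ⋯ + l_k. Then i_-(Γ) = ⌈g/2⌉ + 1 if and only if exactly three of l_1, …, l_k are even. -/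
/-- The negative inertia index of a real symmetric matrix: the number of negative
eigenvalues counted with multiplicity. -/
noncomputable def negInertia {n : Type} [Fintype n] [DecidableEq n]
    {A : Matrix n n ℝ} (hA : A.IsHermitian) : ℕ :=
  (Finset.univ.filter fun i => hA.eigenvalues i < 0).card

open Matrix

/-- The quadratic form in eigencoordinates. -/
theorem quad_eigen {V : Type} [Fintype V] [DecidableEq V] {A : Matrix V V ℝ}
    (hA : A.IsHermitian) : ∃ Q : Matrix V V ℝ, Qᵀ * Q = 1 ∧ Q * Qᵀ = 1 ∧
      ∀ x : V → ℝ, x ⬝ᵥ A *ᵥ x = ∑ i, hA.eigenvalues i * ((Qᵀ *ᵥ x) i) ^ 2 := by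
  refine ⟨(hA.eigenvectorUnitary : Matrix V V ℝ), ?_, ?_, ?_⟩
  · have := Unitary.coe_star_mul_self hA.eigenvectorUnitary
    simpa [star_eq_conjTranspose, conjTranspose_eq_transpose_of_trivial] using this
  · have := Unitary.coe_mul_star_self hA.eigenvectorUnitary
    simpa [star_eq_conjTranspose, conjTranspose_eq_transpose_of_trivial] using this
  · intro x
    have h := hA.spectral_theorem
    rw [Unitary.conjStarAlgAut_apply] at h
    set Q := (hA.eigenvectorUnitary : Matrix V V ℝ) with hQ
    have h2 : A = Q * diagonal hA.eigenvalues * Qᵀ := by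
      conv_lhs => rw [h]
      simp [star_eq_conjTranspose, conjTranspose_eq_transpose_of_trivial, hQ]
    conv_lhs => rw [h2]
    rw [← mulVec_mulVec, ← mulVec_mulVec, dotProduct_mulVec, ← mulVec_transpose]
    simp only [dotProduct, mulVec_diagonal]
    exact Finset.sum_congr rfl fun i _ => by ring

theorem negInertia_le {V : Type} [Fintype V] [DecidableEq V] {A : Matrix V V ℝ}
    (hA : A.IsHermitian) (U : Finset V)
    (hW : ∀ v w, v ∉ U → w ∉ U → A v w = 0) : negInertia hA ≤ U.card := by
  obtain ⟨Q, hQ1, hQ2, hq⟩ := quad_eigen hA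
  by_contra hlt
  push Not at hlt
  set N := Finset.univ.filter fun i => hA.eigenvalues i < 0 with hN
  have hlt' : U.card < N.card := hlt
  let F : Matrix U N ℝ := Q.submatrix Subtype.val Subtype.val
  have hker : LinearMap.ker F.mulVecLin ≠ ⊥ := by
    apply LinearMap.ker_ne_bot_of_finrank_lt
    simpa using hlt'
  obtain ⟨c, hc, hc0⟩ := Submodule.exists_mem_ne_zero_of_ne_bot hker
  have hc' : F *ᵥ c = 0 := by simpa using hc
  let d : V → ℝ := fun i => if h : i ∈ N then c ⟨i, h⟩ else 0
  have hsum : ∀ v, (Q *ᵥ d) v = ∑ i : N, Q v i * c i := by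
    intro v
    simp only [mulVec, dotProduct, d]
    rw [← Finset.sum_subset (Finset.subset_univ N)]
    · rw [← Finset.sum_coe_sort]
      exact Finset.sum_congr rfl fun i _ => by simp
    · intro x _ hx; simp [hx]
  have hx : ∀ v ∈ U, (Q *ᵥ d) v = 0 := by
    intro v hv
    rw [hsum]
    exact congrFun hc' ⟨v, hv⟩
  have h1 : (Q *ᵥ d) ⬝ᵥ A *ᵥ (Q *ᵥ d) = 0 := by
    simp only [dotProduct]
    apply Finset.sum_eq_zero
    intro v _
    by_cases hv : v ∈ U
    · simp [hx v hv]
    · have : (A *ᵥ (Q *ᵥ d)) v = 0 := by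
        rw [mulVec, dotProduct]
        apply Finset.sum_eq_zero
        intro w _
        by_cases hw : w ∈ U
        · simp [hx w hw]
        · simp [hW v w hv hw]
      simp [this]
  rw [hq, mulVec_mulVec, hQ1, one_mulVec] at h1
  have h2 : ∀ i, hA.eigenvalues i * d i ^ 2 ≤ 0 := by
    intro i
    by_cases hi : i ∈ N
    · have : hA.eigenvalues i < 0 := by simpa [hN] using hi
      nlinarith [sq_nonneg (d i)]
    · simp [d, hi]
  rw [Finset.sum_eq_zero_iff_of_nonpos (fun i _ => h2 i)] at h1
  apply hc0
  ext ⟨i, hi⟩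
  have h3 := h1 i (Finset.mem_univ _)
  have : hA.eigenvalues i < 0 := by simpa [hN] using hi
  have h4 : d i = 0 := by simpa [this.ne] using h3
  simpa [d, hi] using h4

theorem le_negInertia_of_neg {V : Type} [Fintype V] [DecidableEq V] {A : Matrix V V ℝ}
    (hA : A.IsHermitian) {U : Type} [Fintype U] [DecidableEq U] (T : Matrix V U ℝ)
    (hT : ∀ y, y ≠ 0 → (T *ᵥ y) ⬝ᵥ A *ᵥ (T *ᵥ y) < 0) : Fintype.card U ≤ negInertia hA := by
  obtain ⟨Q, hQ1, hQ2, hq⟩ := quad_eigen hA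
  by_contra hlt
  push Not at hlt
  set N := Finset.univ.filter fun i => hA.eigenvalues i < 0 with hN
  have hlt' : N.card < Fintype.card U := hlt
  let F : Matrix N U ℝ := (Qᵀ * T).submatrix Subtype.val id
  have hker : LinearMap.ker F.mulVecLin ≠ ⊥ := by
    apply LinearMap.ker_ne_bot_of_finrank_lt
    simpa using hlt'
  obtain ⟨c, hc, hc0⟩ := Submodule.exists_mem_ne_zero_of_ne_bot hker
  have hc' : F *ᵥ c = 0 := by simpa using hc
  have h := hT c hc0
  rw [hq] at h
  apply absurd h
  push Not
  apply Finset.sum_nonneg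
  intro i _
  by_cases hi : i ∈ N
  · have : (Qᵀ *ᵥ T *ᵥ c) i = 0 := by
      rw [mulVec_mulVec]
      exact congrFun hc' ⟨i, hi⟩
    simp [this]
  · have : 0 ≤ hA.eigenvalues i := by simpa [hN] using hi
    positivity

theorem le_negInertia {V : Type} [Fintype V] [DecidableEq V] {A : Matrix V V ℝ}
    (hA : A.IsHermitian) (U : Finset V)
    (hW : ∀ v w, v ∉ U → w ∉ U → A v w = 0)
    (hinj : ∀ y : V → ℝ, (∀ v, v ∉ U → y v = 0) → (∀ v, v ∉ U → (A *ᵥ y) v = 0) → y = 0) :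
    U.card ≤ negInertia hA := by
  let e := Equiv.sumCompl (fun v => v ∈ U)
  have hAs : ∀ i j, A i j = A j i := fun i j => by simpa using (hA.apply i j).symm
  let D : Matrix {v // v ∈ U} {v // v ∈ U} ℝ := A.submatrix Subtype.val Subtype.val
  let M : Matrix {v // ¬ v ∈ U} {v // v ∈ U} ℝ := A.submatrix Subtype.val Subtype.val
  have hDs : Dᵀ = D := by ext i j; exact hAs _ _
  have hblock : A.submatrix e e = fromBlocks D Mᵀ M 0 := by
    ext i j
    rcases i with i | i <;> rcases j with j | j
    · rfl
    · exact hAs _ _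
    · rfl
    · exact hW _ _ i.2 j.2
  have hMinj : Function.Injective M.mulVec := by
    have : Function.Injective M.mulVecLin := by
      rw [← LinearMap.ker_eq_bot, LinearMap.ker_eq_bot']
      intro y hy
      have hy' : M *ᵥ y = 0 := by simpa using hy
      have := hinj (fun v => if h : v ∈ U then y ⟨v, h⟩ else 0) (fun v hv => by simp [hv])
        (fun v hv => by
          have h := congrFun hy' ⟨v, hv⟩
          simp only [mulVec, dotProduct] at h ⊢
          rw [← Finset.sum_subset (Finset.subset_univ U) (by intro x _ hx; simp [hx]),
            ← Finset.sum_coe_sort]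
          refine Eq.trans ?_ h
          exact Finset.sum_congr rfl fun i _ => by simp [M])
      ext ⟨v, hv⟩
      simpa [hv] using congrFun this v
    exact this
  have hpd : (Mᵀ * M).PosDef := by
    have := PosDef.conjTranspose_mul_self M hMinj
    simpa [conjTranspose_eq_transpose_of_trivial] using this
  have hu : IsUnit (Mᵀ * M).det := by
    rw [← isUnit_iff_isUnit_det]; exact hpd.isUnit
  let K : Matrix {v // ¬ v ∈ U} {v // v ∈ U} ℝ := M * ((Mᵀ * M)⁻¹ * ((-(1/2) : ℝ) • (D + 1)))
  have hK : Mᵀ * K = (-(1/2) : ℝ) • (D + 1) := by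
    simp only [K]
    rw [← Matrix.mul_assoc, ← Matrix.mul_assoc, mul_nonsing_inv _ hu, Matrix.one_mul]
  have := le_negInertia_of_neg hA ((fromRows (1 : Matrix {v // v ∈ U} {v // v ∈ U} ℝ) K).submatrix
    e.symm id) (by
    intro y hy
    have hx : ((fromRows (1 : Matrix {v // v ∈ U} {v // v ∈ U} ℝ) K).submatrix e.symm id) *ᵥ y
        = (Sum.elim y (K *ᵥ y)) ∘ e.symm := by
      ext v
      change (fromRows (1 : Matrix {v // v ∈ U} {v // v ∈ U} ℝ) K *ᵥ y) (e.symm v) = _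
      rw [fromRows_mulVec, one_mulVec]; rfl
    rw [hx]
    have hA2 : A = (fromBlocks D Mᵀ M 0).submatrix e.symm e.symm := by
      rw [← hblock]; simp
    have h5 : A *ᵥ ((Sum.elim y (K *ᵥ y)) ∘ e.symm)
        = (fromBlocks D Mᵀ M 0 *ᵥ (Sum.elim y (K *ᵥ y))) ∘ e.symm := by
      conv_lhs => rw [hA2]
      rw [submatrix_mulVec_equiv]
      congr 2
      ext i; simp
    rw [h5, comp_equiv_dotProduct_comp_equiv, fromBlocks_mulVec]
    rw [sumElim_dotProduct_sumElim]
    have e1 : (Sum.elim y (K *ᵥ y)) ∘ Sum.inl = y := rfl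
    have e2 : (Sum.elim y (K *ᵥ y)) ∘ Sum.inr = K *ᵥ y := rfl
    rw [e1, e2, mulVec_mulVec, hK]
    have e3 : (K *ᵥ y) ⬝ᵥ (M *ᵥ y) = y ⬝ᵥ ((Mᵀ * K) *ᵥ y) := by
      rw [dotProduct_mulVec, ← mulVec_transpose, mulVec_mulVec, dotProduct_comm]
    simp only [zero_mulVec, add_zero]
    rw [e3, hK]
    simp only [smul_mulVec, add_mulVec, one_mulVec, dotProduct_add, dotProduct_smul, smul_eq_mul]
    have hpos : 0 < y ⬝ᵥ y := by
      have h0 : 0 ≤ y ⬝ᵥ y := Finset.sum_nonneg fun i _ => mul_self_nonneg _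
      exact lt_of_le_of_ne h0 (fun h => hy (dotProduct_self_eq_zero.mp h.symm))
    linarith)
  simpa using this

theorem walk_along {V : Type} (G : SimpleGraph V) (g : ℕ) (f : ZMod g → V)
    (hfinj : Function.Injective f) (hcyc : ∀ m : ZMod g, G.Adj (f m) (f (m + 1)))
    (m : ZMod g) (d : ℕ) (hd : d < g) :
    ∃ p : G.Walk (f m) (f (m + (d : ℕ))), p.IsPath ∧ p.length = d ∧
      (∀ v ∈ p.support, ∃ j : ℕ, j ≤ d ∧ v = f (m + (j : ℕ))) ∧
      (∀ x ∈ p.edges, ∃ j : ℕ, j < d ∧ x = s(f (m + (j : ℕ)), f (m + ((j + 1 : ℕ) : ZMod g)))) := by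
  induction d with
  | zero =>
    have h0 : f m = f (m + ((0 : ℕ) : ZMod g)) := by simp
    refine ⟨SimpleGraph.Walk.nil.copy rfl h0, ?_, ?_, ?_, ?_⟩ <;> simp
  | succ d ih =>
    obtain ⟨p, hp, hlen, hsup, hedge⟩ := ih (by omega)
    have hadj : G.Adj (f (m + (d : ℕ))) (f (m + ((d + 1 : ℕ) : ZMod g))) := by
      have := hcyc (m + (d : ℕ))
      push_cast
      rwa [← add_assoc]
    refine ⟨p.concat hadj, ?_, ?_, ?_, ?_⟩
    · refine hp.concat ?_ hadj
      intro hmem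
      obtain ⟨j, hj, hj2⟩ := hsup _ hmem
      have h3 := add_left_cancel (hfinj hj2)
      rw [ZMod.natCast_eq_natCast_iff'] at h3
      rw [Nat.mod_eq_of_lt hd, Nat.mod_eq_of_lt (by omega)] at h3
      omega
    · simp [hlen]
    · intro v hv
      rw [SimpleGraph.Walk.support_concat] at hv
      simp only [List.mem_append, List.mem_singleton] at hv
      rcases hv with hv | hv
      · obtain ⟨j, hj, hj2⟩ := hsup _ hv
        exact ⟨j, by omega, hj2⟩
      · exact ⟨d + 1, le_rfl, hv⟩
    · intro x hx
      rw [SimpleGraph.Walk.edges_concat] at hx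
      simp only [List.concat_eq_append, List.mem_append, List.mem_singleton] at hx
      rcases hx with hx | hx
      · obtain ⟨j, hj, hj2⟩ := hedge _ hx
        exact ⟨j, by omega, hj2⟩
      · exact ⟨d, by omega, hx⟩

theorem no_chord {V : Type} (G : SimpleGraph V) (g : ℕ) (hg : 0 < g) (hgirth : G.girth = g)
    (f : ZMod g → V)
    (hfinj : Function.Injective f) (hcyc : ∀ m : ZMod g, G.Adj (f m) (f (m + 1)))
    (m m' : ZMod g) (h : G.Adj (f m) (f m')) : m' = m + 1 ∨ m = m' + 1 := by
  have : NeZero g := ⟨hg.ne'⟩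
  set d := (m' - m).val with hd
  have hdg : d < g := ZMod.val_lt _
  have hm' : m' = m + (d : ℕ) := by rw [hd, ZMod.natCast_zmod_val]; ring
  by_contra hcon
  push Not at hcon
  have hd0 : d ≠ 0 := by
    intro h0
    rw [h0] at hm'
    simp at hm'
    exact h.ne (by rw [hm'])
  have hd1 : d ≠ 1 := by
    intro h0
    rw [h0] at hm'
    exact hcon.1 (by simpa using hm')
  have hdl : d + 1 ≠ g := by
    intro h0
    apply hcon.2
    rw [hm', add_assoc]
    have : ((d : ℕ) : ZMod g) + 1 = ((d + 1 : ℕ) : ZMod g) := by push_cast; rfl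
    rw [this, h0]; simp
  obtain ⟨p, hp, hlen, -, hedge⟩ := walk_along G g f hfinj hcyc m d hdg
  rw [hm'] at h
  have hc : (SimpleGraph.Walk.cons h.symm p).IsCycle := by
    rw [SimpleGraph.Walk.cons_isCycle_iff]
    refine ⟨hp, fun hmem => ?_⟩
    obtain ⟨j, hj, hj2⟩ := hedge _ hmem
    have key : ∀ i : ℕ, i < g → m = m + (i : ℕ) → i = 0 := by
      intro i hi h4
      have h5 : ((i : ℕ) : ZMod g) = ((0 : ℕ) : ZMod g) := by
        have : m + 0 = m + (i : ℕ) := by simpa using h4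
        simpa using (add_left_cancel this).symm
      rw [ZMod.natCast_eq_natCast_iff', Nat.mod_eq_of_lt hi] at h5
      simpa using h5
    rw [Sym2.eq_iff] at hj2
    rcases hj2 with ⟨-, h2⟩ | ⟨h1, h2⟩
    · have := key _ (by omega) (hfinj h2)
      omega
    · have h3 := key _ (by omega) (hfinj h2)
      subst h3
      have h4 := add_left_cancel (hfinj h1)
      rw [ZMod.natCast_eq_natCast_iff', Nat.mod_eq_of_lt hdg, Nat.mod_eq_of_lt (by omega)] at h4
      omega
  have := SimpleGraph.girth_le_length hc
  rw [hgirth, SimpleGraph.Walk.length_cons, hlen] at this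
  omega

theorem count_even {k : ℕ} (l : Fin k → ℕ) :
    2 * (Finset.univ.filter fun p : (Σ i : Fin k, Fin (l i + 1)) => Even (p.2 : ℕ)).card =
      (k + ∑ i, l i) + (Finset.univ.filter fun i => Even (l i)).card := by
  have hF : ∀ n : ℕ, (Finset.univ.filter fun j : Fin (n + 1) => Even (j : ℕ)).card = n / 2 + 1 := by
    intro n
    rw [Finset.card_filter, Fin.sum_univ_eq_sum_range (fun j => if Even j then 1 else 0)]
    induction n with
    | zero => rfl
    | succ n ih =>
      rw [Finset.sum_range_succ, ih]
      split_ifs with h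
      · obtain ⟨r, hr⟩ := h; omega
      · rw [Nat.not_even_iff_odd] at h; obtain ⟨r, hr⟩ := h; omega
  have h1 : (Finset.univ.filter fun p : (Σ i : Fin k, Fin (l i + 1)) => Even (p.2 : ℕ)).card
      = ∑ i, (l i / 2 + 1) := by
    rw [Finset.card_filter, Fintype.sum_sigma]
    refine Finset.sum_congr rfl fun i _ => ?_
    rw [← hF, Finset.card_filter]
  rw [h1, Finset.card_filter, Finset.mul_sum]
  have hk : k + ∑ i, l i = ∑ i : Fin k, (1 + l i) := by simp [Finset.sum_add_distrib]
  rw [hk, ← Finset.sum_add_distrib]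
  refine Finset.sum_congr rfl fun i _ => ?_
  split_ifs with h
  · obtain ⟨r, hr⟩ := h; omega
  · rw [Nat.not_even_iff_odd] at h; obtain ⟨r, hr⟩ := h; omega

theorem stmt_1 {V : Type} [Fintype V] [DecidableEq V]
    (G : SimpleGraph V) (A : Matrix V V ℝ) (hA : A.IsHermitian)
    (hone : ∀ u v, G.Adj u v → A u v = 1 ∨ A u v = -1)
    (hzero : ∀ u v, ¬ G.Adj u v → A u v = 0)
    (g : ℕ) (hgirth : G.girth = (g : ℕ∞)) (hmod : g % 4 = 1 ∨ g % 4 = 3)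
    (f : ZMod g → V) (hfinj : Function.Injective f)
    (hcyc : ∀ m : ZMod g, G.Adj (f m) (f (m + 1)))
    (hpend : ∀ v, v ∉ Set.range f → ∃! u, u ∈ Set.range f ∧ G.Adj v u)
    (hind : ∀ v w, v ∉ Set.range f → w ∉ Set.range f → ¬ G.Adj v w)
    (hnotcycle : ∃ v, v ∉ Set.range f)
    (k : ℕ) (hk : 1 ≤ k)
    (a : Fin k → ℕ) (ha : StrictMono a) (halt : ∀ i, a i < g)
    (hmaj : ∀ m : ZMod g,
      ((∃ w, w ∉ Set.range f ∧ G.Adj (f m) w) ↔ ∃ i : Fin k, m = (a i : ZMod g)))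
    (l : Fin k → ℕ)
    (hl : ∀ i : Fin k, ∀ h : (i : ℕ) + 1 < k, a ⟨(i : ℕ) + 1, h⟩ = a i + l i + 1)
    (hlast : g + a ⟨0, by omega⟩ = a ⟨k - 1, by omega⟩ + l ⟨k - 1, by omega⟩ + 1)
    (hsum : g = k + (∑ i, l i)) :
    negInertia hA = (g + 1) / 2 + 1 ↔
      (Finset.univ.filter fun i => Even (l i)).card = 3 := by
  have hg : 0 < g := by omega
  have : NeZero g := ⟨hg.ne'⟩
  have hgirth' : G.girth = g := by exact_mod_cast hgirth
  have hchord := no_chord G g hg hgirth' f hfinj hcyc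
  let φ : (Σ i : Fin k, Fin (l i + 1)) → ZMod g := fun p => ((a p.1 + p.2 : ℕ) : ZMod g)
  have hnext : ∀ i : Fin k, ∃ i' : Fin k, ((a i + l i : ℕ) : ZMod g) + 1 = (a i' : ZMod g) := by
    intro i
    by_cases h : (i : ℕ) + 1 < k
    · refine ⟨⟨(i : ℕ) + 1, h⟩, ?_⟩
      rw [hl i h]; push_cast; ring
    · have hi : i = ⟨k - 1, by omega⟩ := by ext; simp; omega
      refine ⟨⟨0, by omega⟩, ?_⟩
      have hai : a i = a ⟨k - 1, by omega⟩ := congrArg a hi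
      have hli : l i = l ⟨k - 1, by omega⟩ := congrArg l hi
      rw [hai, hli]
      have := congrArg (Nat.cast : ℕ → ZMod g) hlast
      push_cast at this ⊢
      rw [← this]; simp
  have hstep : ∀ i : Fin k, ∀ j : ℕ, j < l i →
      ((a i + j : ℕ) : ZMod g) + 1 = ((a i + (j + 1) : ℕ) : ZMod g) := by
    intro i j _; push_cast; ring
  have hsucc : ∀ p, ∃ q, φ q = φ p + 1 := by
    rintro ⟨i, j, hj⟩
    by_cases h : j < l i
    · exact ⟨⟨i, ⟨j + 1, by omega⟩⟩, (hstep i j h).symm⟩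
    · have hjl : j = l i := by omega
      subst hjl
      obtain ⟨i', hi'⟩ := hnext i
      exact ⟨⟨i', 0⟩, by simp only [φ]; rw [hi']; simp⟩
  have hsurj : Function.Surjective φ := by
    have h1 : ∀ n : ℕ, ∃ q, φ q = φ ⟨⟨0, by omega⟩, 0⟩ + (n : ℕ) := by
      intro n
      induction n with
      | zero => exact ⟨_, by simp; rfl⟩
      | succ n ih =>
        obtain ⟨q, hq⟩ := ih
        obtain ⟨r, hr⟩ := hsucc q
        exact ⟨r, by rw [hr, hq]; push_cast; ring⟩
    intro m
    obtain ⟨q, hq⟩ := h1 (m - φ ⟨⟨0, by omega⟩, 0⟩).val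
    exact ⟨q, by rw [hq, ZMod.natCast_zmod_val]; ring⟩
  have hbij : Function.Bijective φ := by
    rw [Fintype.bijective_iff_surjective_and_card]
    refine ⟨hsurj, ?_⟩
    rw [ZMod.card, Fintype.card_sigma]
    simp only [Fintype.card_fin]
    rw [Finset.sum_add_distrib]
    simp
    omega
  let E : Finset (Σ i : Fin k, Fin (l i + 1)) := Finset.univ.filter fun p => Even (p.2 : ℕ)
  let U : Finset V := E.image (fun p => f (φ p))
  have hUcard : U.card = E.card := Finset.card_image_of_injective _ (hfinj.comp hbij.1)
  have hUmem : ∀ p, f (φ p) ∈ U ↔ Even (p.2 : ℕ) := by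
    intro p
    simp only [U, Finset.mem_image]
    constructor
    · rintro ⟨q, hq, hqp⟩
      have : q = p := hbij.1 (hfinj hqp)
      subst this
      simpa [E] using hq
    · intro hp
      exact ⟨p, by simpa [E] using hp, rfl⟩
  have hUrange : ∀ v ∈ U, ∃ p, v = f (φ p) := by
    intro v hv
    simp only [U, Finset.mem_image] at hv
    obtain ⟨q, -, hq⟩ := hv
    exact ⟨q, hq.symm⟩
  have hUmaj : ∀ i : Fin k, f (a i : ZMod g) ∈ U := by
    intro i
    have := (hUmem ⟨i, 0⟩).2 (by simp)
    simpa [φ] using this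
  have hUsucc : ∀ m : ZMod g, f m ∉ U → f (m + 1) ∈ U := by
    intro m hm
    obtain ⟨⟨i, j, hj⟩, rfl⟩ := hsurj m
    rw [hUmem] at hm
    by_cases h : j < l i
    · have h2 : f (φ ⟨i, ⟨j + 1, by omega⟩⟩) ∈ U := by
        rw [hUmem]
        simpa [Nat.even_add_one] using hm
      have h3 : φ ⟨i, ⟨j, hj⟩⟩ + 1 = φ ⟨i, ⟨j + 1, by omega⟩⟩ := hstep i j h
      rw [h3]; exact h2
    · have hjl : j = l i := by omega
      subst hjl
      obtain ⟨i', hi'⟩ := hnext i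
      have h3 : φ ⟨i, ⟨l i, hj⟩⟩ + 1 = (a i' : ZMod g) := hi'
      rw [h3]; exact hUmaj i'
  have hW : ∀ v w, v ∉ U → w ∉ U → A v w = 0 := by
    intro v w hv hw
    apply hzero
    intro hadj
    by_cases hv' : v ∈ Set.range f
    · obtain ⟨m, rfl⟩ := hv'
      by_cases hw' : w ∈ Set.range f
      · obtain ⟨m', rfl⟩ := hw'
        rcases hchord _ _ hadj with h | h
        · rw [h] at hw; exact hw (hUsucc m hv)
        · rw [h] at hv; exact hv (hUsucc m' hw)
      · obtain ⟨i, hi⟩ := (hmaj m).1 ⟨w, hw', hadj⟩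
        rw [hi] at hv; exact hv (hUmaj i)
    · by_cases hw' : w ∈ Set.range f
      · obtain ⟨m', rfl⟩ := hw'
        obtain ⟨i, hi⟩ := (hmaj m').1 ⟨v, hv', hadj.symm⟩
        rw [hi] at hw; exact hw (hUmaj i)
      · exact hind v w hv' hw' hadj
  have hne : ∀ u v, G.Adj u v → A u v ≠ 0 := by
    intro u v h
    rcases hone u v h with h | h <;> rw [h] <;> norm_num
  have hinj : ∀ y : V → ℝ, (∀ v, v ∉ U → y v = 0) →
      (∀ v, v ∉ U → (A *ᵥ y) v = 0) → y = 0 := by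
    intro y hy hAy
    have hsolve : ∀ w v, w ∉ U → G.Adj w v → (∀ u ∈ U, G.Adj w u → u ≠ v → y u = 0) →
        y v = 0 := by
      intro w v hw hadj hoth
      have h := hAy w hw
      rw [mulVec, dotProduct, Finset.sum_eq_single v] at h
      · exact (mul_eq_zero.1 h).resolve_left (hne _ _ hadj)
      · intro u _ huv
        by_cases hu : u ∈ U
        · by_cases ha : G.Adj w u
          · rw [hoth u hu ha huv, mul_zero]
          · rw [hzero _ _ ha, zero_mul]
        · rw [hy u hu, mul_zero]
      · intro h; exact absurd (Finset.mem_univ _) h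
    have hmain : ∀ j : ℕ, ∀ i : Fin k, j ≤ l i → y (f ((a i + j : ℕ) : ZMod g)) = 0 := by
      intro j
      induction j using Nat.strong_induction_on with
      | _ j ih =>
        intro i hj
        by_cases hev : Even j
        · rcases Nat.eq_zero_or_pos j with h0 | hpos
          · subst h0
            obtain ⟨w, hw, hadj⟩ := (hmaj (a i : ZMod g)).2 ⟨i, rfl⟩
            simp only [add_zero]
            apply hsolve w _ (fun hwU => ?_) hadj.symm
            · intro u hu hadj' hne'
              obtain ⟨p, rfl⟩ := hUrange u hu
              exact absurd ((hpend w hw).unique ⟨⟨_, rfl⟩, hadj'⟩ ⟨⟨_, rfl⟩, hadj.symm⟩) hne'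
            · obtain ⟨p, rfl⟩ := hUrange w hwU
              exact hw ⟨_, rfl⟩
          · obtain ⟨r, hr⟩ := hev
            obtain ⟨t, rfl⟩ : ∃ t, j = t + 2 := ⟨j - 2, by omega⟩
            have hodd : ¬ Even (t + 1) := by
              rw [Nat.not_even_iff_odd]; exact ⟨r - 1, by omega⟩
            have hw : f ((a i + (t + 1) : ℕ) : ZMod g) ∉ U := by
              intro h
              exact hodd ((hUmem ⟨i, ⟨t + 1, by omega⟩⟩).1 h)
            have hs1 := hstep i (t + 1) (by omega)
            have hs0 := hstep i t (by omega)
            apply hsolve _ _ hw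
            · have := hcyc ((a i + (t + 1) : ℕ) : ZMod g)
              rwa [hs1] at this
            · intro u hu hadj hne'
              obtain ⟨p, rfl⟩ := hUrange u hu
              rcases hchord _ _ hadj with h | h
              · rw [h, hs1] at hne'
                exact absurd rfl hne'
              · rw [← hs0] at h
                rw [← add_right_cancel h]
                exact ih t (by omega) i (by omega)
        · apply hy
          intro h
          exact hev ((hUmem ⟨i, ⟨j, by omega⟩⟩).1 h)
    ext v
    by_cases hv : v ∈ U
    · obtain ⟨⟨i, j, hj⟩, rfl⟩ := hUrange v hv
      exact hmain j i (by omega)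
    · exact hy v hv
  have hfinal : negInertia hA = U.card :=
    le_antisymm (negInertia_le hA U hW) (le_negInertia hA U hW hinj)
  have hcount := count_even l
  rw [← hsum] at hcount
  change 2 * E.card = _ at hcount
  rw [hfinal, hUcard]
  omega
end

section
/- Let Γ be a canonical signed unicyclic graph with girth g ≡ 0 or 2 (mod 4) whose unique cycle C has length g, and suppose Γ is not itself a cycle. Let v_1, …, v_k (k ≥ 1) be the major vertices of Γ listed in cyclic order along C, and let l_1, …, l_k ≥ 0 be the numbers of vertices on the k arcs of C strictly between consecutive major vertices, so that g = k + l_1 + ⋯ + l_k. Then i_-(Γ) = ⌈g/2⌉ + 1 if and only if exactly two of l_1, …, l_k are even. -/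
/-- A symmetric matrix anticommuting with a signature has negative inertia half its rank. -/
lemma two_negInertia_eq_rank {V : Type} [Fintype V] [DecidableEq V]
    (A : Matrix V V ℝ) (hA : A.IsHermitian) (d : V → ℝ) (hd : ∀ v, d v * d v = 1)
    (hanti : ∀ u v, A u v ≠ 0 → d u = - d v) : 2 * negInertia hA = A.rank := by
  classical
  have h1 : Matrix.diagonal d * A * Matrix.diagonal d = -A := by
    ext u v
    rw [Matrix.mul_diagonal, Matrix.diagonal_mul, Matrix.neg_apply]
    by_cases h : A u v = 0
    · simp [h]
    · rw [hanti u v h]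
      have := hd v
      linear_combination (-A u v) * this
  have h2 : (-A).charpoly = A.charpoly := by
    rw [← h1, Matrix.charpoly_mul_comm, ← mul_assoc, Matrix.diagonal_mul_diagonal]
    simp [hd]
  have h3 : (-A).charpoly = ∏ i, (Polynomial.X - Polynomial.C (-hA.eigenvalues i)) := by
    conv_lhs => rw [hA.spectral_theorem, Unitary.conjStarAlgAut_apply, ← neg_mul, ← mul_neg,
      Matrix.charpoly_mul_comm, ← mul_assoc]
    rw [Unitary.coe_star_mul_self, one_mul, Matrix.diagonal_neg, Matrix.charpoly_diagonal]
    simp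
  have h4 : Multiset.map (fun i => - hA.eigenvalues i) Finset.univ.val
      = Multiset.map (fun i => hA.eigenvalues i) Finset.univ.val := by
    have e1 := hA.roots_charpoly_eq_eigenvalues
    rw [← h2, h3, Polynomial.roots_prod _ _ (Finset.prod_ne_zero_iff.mpr fun i _ => Polynomial.X_sub_C_ne_zero _)] at e1
    simpa [Function.comp_def] using e1
  have h5 : (Finset.univ.filter fun i => 0 < hA.eigenvalues i).card = negInertia hA := by
    have := congrArg (fun s => Multiset.card (Multiset.filter (fun x => x < 0) s)) h4
    simp only [Multiset.filter_map, Multiset.card_map] at this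
    unfold negInertia
    simpa [Finset.card_def, Finset.filter_val, Function.comp_def] using this
  rw [hA.rank_eq_card_non_zero_eigs, Fintype.card_subtype, two_mul]
  nth_rw 1 [← h5]
  unfold negInertia
  rw [← Finset.card_union_of_disjoint]
  · congr 1
    ext i
    simp only [Finset.mem_union, Finset.mem_filter, Finset.mem_univ, true_and]
    rw [or_comm, ne_iff_lt_or_gt]
  · rw [Finset.disjoint_filter]
    intro i _ h
    linarith

lemma zmod_two_succ : ∀ y : ZMod 2, y + 1 = 0 ↔ ¬ y = 0 := by decide

lemma zmod_cast_inj {g : ℕ} {x y : ℕ} (hx : x < g) (hy : y < g)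
    (h : (x : ZMod g) = (y : ZMod g)) : x = y := by
  rw [ZMod.natCast_eq_natCast_iff', Nat.mod_eq_of_lt hx, Nat.mod_eq_of_lt hy] at h
  exact h

lemma cycle_walk {V : Type} (G : SimpleGraph V) (g : ℕ) 
    (f : ZMod g → V) (hfinj : Function.Injective f)
    (hcyc : ∀ m : ZMod g, G.Adj (f m) (f (m + 1))) (m : ZMod g) (d : ℕ) (hd : d < g) :
    ∃ p : G.Walk (f m) (f (m + d)), p.IsPath ∧ p.length = d ∧
      (∀ v ∈ p.support, ∃ i : ℕ, i ≤ d ∧ v = f (m + i)) ∧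
      (∀ e ∈ p.edges, ∃ i : ℕ, i < d ∧ e = s(f (m + i), f (m + i + 1))) := by
  induction d with
  | zero =>
    have : f m = f (m + (0:ℕ)) := by simp
    rw [← this]
    refine ⟨SimpleGraph.Walk.nil, by simp, by simp, ?_, by simp⟩
    intro v hv
    exact ⟨0, le_rfl, by simpa using hv⟩
  | succ d ih =>
    obtain ⟨p, hp, hl, hs, he⟩ := ih (by omega)
    have hadj := hcyc (m + d)
    have e : m + ((d + 1 : ℕ) : ZMod g) = m + d + 1 := by push_cast; ring
    rw [e]
    refine ⟨p.concat hadj, ?_, by simp [hl], ?_, ?_⟩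
    · rw [SimpleGraph.Walk.concat_isPath_iff]
      refine ⟨hp, fun hmem => ?_⟩
      obtain ⟨i, hi, h⟩ := hs _ hmem
      have h := hfinj h
      rw [← e] at h
      have := zmod_cast_inj hd (by omega) (add_left_cancel h)
      omega
    · intro v hv
      rw [SimpleGraph.Walk.support_concat] at hv
      simp only [List.concat_eq_append, List.mem_append, List.mem_singleton] at hv
      rcases hv with hv | hv
      · obtain ⟨i, hi, h⟩ := hs _ hv
        exact ⟨i, by omega, h⟩
      · exact ⟨d + 1, le_rfl, by rw [hv, e]⟩
    · intro v hv
      rw [SimpleGraph.Walk.edges_concat] at hv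
      simp only [List.concat_eq_append, List.mem_append, List.mem_singleton] at hv
      rcases hv with hv | hv
      · obtain ⟨i, hi, h⟩ := he _ hv
        exact ⟨i, by omega, h⟩
      · exact ⟨d, by omega, hv⟩

/-- A shortest cycle has no chord. -/
lemma chordless {V : Type} (G : SimpleGraph V) (g : ℕ) (hg : 3 ≤ g) (hgirth : G.girth = g)
    (f : ZMod g → V) (hfinj : Function.Injective f)
    (hcyc : ∀ m : ZMod g, G.Adj (f m) (f (m + 1))) (m n : ZMod g)
    (h : G.Adj (f m) (f n)) : n = m + 1 ∨ n = m - 1 := by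
  have : NeZero g := ⟨by omega⟩
  obtain ⟨d, hd, hn⟩ : ∃ d : ℕ, d < g ∧ n = m + d :=
    ⟨(n - m).val, ZMod.val_lt _, by rw [ZMod.natCast_zmod_val]; ring⟩
  by_cases h0 : d = 0
  · subst h0; simp [hn] at h
  by_cases h1 : d = 1
  · subst h1; left; simpa using hn
  by_cases h2 : d = g - 1
  · right
    rw [hn, h2, Nat.cast_sub (by omega)]
    simp; ring
  exfalso
  obtain ⟨p, hp, hl, hs, he⟩ := cycle_walk G g f hfinj hcyc m d hd
  rw [hn] at h
  have hc : (SimpleGraph.Walk.cons h.symm p).IsCycle := by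
    rw [SimpleGraph.Walk.cons_isCycle_iff]
    refine ⟨hp, fun hmem => ?_⟩
    obtain ⟨i, hi, hh⟩ := he _ hmem
    rw [Sym2.eq_iff] at hh
    rcases hh with ⟨hh, hh'⟩ | ⟨hh, hh'⟩
    · have := zmod_cast_inj hd (by omega) (add_left_cancel (hfinj hh))
      omega
    · have h3 := hfinj hh
      have : d = i + 1 := by
        apply zmod_cast_inj hd (by omega)
        apply add_left_cancel (a := m)
        rw [h3]; push_cast; ring
      have h4 : m + ((0:ℕ) : ZMod g) = m + i := by simpa using hfinj hh'
      have := zmod_cast_inj (by omega) (by omega) (add_left_cancel h4)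
      omega
  have := SimpleGraph.girth_le_length hc
  simp [hl, hgirth] at this
  omega

/-- Solution of the two-term recurrence along an arc. -/
noncomputable def arcSol (b c : ℕ → ℝ) : ℕ → ℝ
  | 0 => 0
  | 1 => 1
  | (j + 2) => - (b j / c j) * arcSol b c j

lemma arcSol_even (b c : ℕ → ℝ) (j : ℕ) : arcSol b c (2 * j) = 0 := by
  induction j with
  | zero => simp [arcSol]
  | succ j ih => rw [show 2 * (j + 1) = 2 * j + 2 by ring, arcSol, ih, mul_zero]

lemma arcSol_odd (b c : ℕ → ℝ) (hb : ∀ j, b j ≠ 0) (hc : ∀ j, c j ≠ 0) (j : ℕ) :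
    arcSol b c (2 * j + 1) ≠ 0 := by
  induction j with
  | zero => simp [arcSol]
  | succ j ih =>
    rw [show 2 * (j + 1) + 1 = 2 * j + 1 + 2 by ring, arcSol]
    exact mul_ne_zero (neg_ne_zero.mpr (div_ne_zero (hb _) (hc _))) ih

lemma rank_arcs {V ι P : Type} [Fintype V] [DecidableEq V] [Fintype ι] [DecidableEq ι]
    [Fintype P] [DecidableEq P]
    (A : Matrix V V ℝ) (l : ι → ℕ) (c : ι → ℕ → V)
    (Φ : ((i : ι) × Fin (l i + 1)) ⊕ P ≃ V)
    (hΦ : ∀ i (j : Fin (l i + 1)), Φ (Sum.inl ⟨i, j⟩) = c i j)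
    (hnext : ∀ i, ∃ i', c i (l i + 1) = c i' 0)
    (par : P → ι) (hpar : Function.Surjective par)
    (α : P → ℝ) (hα : ∀ w, α w ≠ 0)
    (hrowP : ∀ w x, (A.mulVec x) (Φ (Sum.inr w)) = α w * x (c (par w) 0))
    (β γ : ι → ℕ → ℝ) (hβ : ∀ i j, β i j ≠ 0) (hγ : ∀ i j, γ i j ≠ 0)
    (hrowI : ∀ i j, j + 1 ≤ l i → ∀ x, (A.mulVec x) (c i (j + 1)) =
      β i j * x (c i j) + γ i j * x (c i (j + 2)))
    (hmajne : ∀ w, A (c (par w) 0) (Φ (Sum.inr w)) ≠ 0)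
    (hmajz : ∀ i w, par w ≠ i → A (c i 0) (Φ (Sum.inr w)) = 0) :
    A.rank + Fintype.card {i // Odd (l i)} = (∑ i, (l i + 1)) + Fintype.card ι := by
  classical
  set z : ι → ℕ → ℝ := fun i => arcSol (β i) (γ i) with hz
  let T : ({i // Odd (l i)} → ℝ) → ι → ℝ := fun t i => if h : Odd (l i) then t ⟨i, h⟩ else 0
  let X : (({i // Odd (l i)} → ℝ) × (P → ℝ)) →ₗ[ℝ] (V → ℝ) :=
    { toFun := fun ty v => Sum.elim (fun s => T ty.1 s.1 * z s.1 s.2) ty.2 (Φ.symm v)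
      map_add' := by
        intro p q
        ext v
        simp only [Pi.add_apply, Pi.smul_apply]
        rcases Φ.symm v with s | w
        · by_cases h : Odd (l s.1)
          · simp [T, h]; try ring
          · simp [T, h]
        · simp
      map_smul' := by
        intro r p
        ext v
        simp only [Pi.add_apply, Pi.smul_apply]
        rcases Φ.symm v with s | w
        · by_cases h : Odd (l s.1)
          · simp [T, h]; try ring
          · simp [T, h]
        · simp }
  have hXc : ∀ ty i j, j ≤ l i → X ty (c i j) = T ty.1 i * z i j := by
    intro ty i j hj
    have : c i j = Φ (Sum.inl ⟨i, ⟨j, by omega⟩⟩) := (hΦ i ⟨j, by omega⟩).symm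
    rw [this]; simp [X]
  have hXw : ∀ ty w, X ty (Φ (Sum.inr w)) = ty.2 w := by
    intro ty w; simp [X]
  have hX0 : ∀ ty i, X ty (c i 0) = 0 := by
    intro ty i; rw [hXc _ _ _ (Nat.zero_le _)]; simp [hz, arcSol]
  have hXc' : ∀ ty i j, j ≤ l i + 1 → X ty (c i j) = T ty.1 i * z i j := by
    intro ty i j hj
    rcases Nat.lt_or_ge (l i) j with h | h
    · have : j = l i + 1 := by omega
      subst this
      obtain ⟨i', hi'⟩ := hnext i
      rw [hi', hX0]
      by_cases ho : Odd (l i)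
      · obtain ⟨r, hr⟩ := ho
        rw [hz, hr]
        simp only
        rw [show 2 * r + 1 + 1 = 2 * (r + 1) by ring, arcSol_even, mul_zero]
      · simp [T, ho]
    · exact hXc _ _ _ h
  have hXinj : Function.Injective X := by
    rw [← LinearMap.ker_eq_bot, LinearMap.ker_eq_bot']
    intro ty h
    ext a
    · obtain ⟨i, hi⟩ := a
      have h1 := hXc ty i 1 hi.pos
      rw [h] at h1
      simp [T, hi, hz, arcSol] at h1
      simpa using h1.symm
    · have := hXw ty a
      rw [h] at this
      simpa using this.symm
  let N : (({i // Odd (l i)} → ℝ) × (P → ℝ)) →ₗ[ℝ] (ι → ℝ) :=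
    (LinearMap.funLeft ℝ ℝ (fun i => c i 0)) ∘ₗ A.mulVecLin ∘ₗ X
  have hN : ∀ ty i, N ty i = (A.mulVec (X ty)) (c i 0) := fun ty i => rfl
  have hker : (LinearMap.ker A.mulVecLin) = (LinearMap.ker N).map X := by
    ext x
    simp only [LinearMap.mem_ker, Submodule.mem_map, Matrix.mulVecLin_apply]
    constructor
    · intro hx
      have hx0 : ∀ i, x (c i 0) = 0 := by
        intro i
        obtain ⟨w, rfl⟩ := hpar i
        have := hrowP w x
        rw [hx] at this
        simpa [hα w] using this.symm
      have hxj : ∀ i j, j ≤ l i → x (c i j) = x (c i 1) * z i j ∧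
          x (c i (j + 1)) = x (c i 1) * z i (j + 1) := by
        intro i j
        induction j with
        | zero => intro _; simp [hx0, hz, arcSol]
        | succ j ih =>
          intro hj
          obtain ⟨h1, h2⟩ := ih (by omega)
          refine ⟨h2, ?_⟩
          have := hrowI i j hj x
          rw [hx, h1] at this
          simp only [Pi.zero_apply] at this
          have e : z i (j + 1 + 1) = - (β i j / γ i j) * z i j := by simp [hz, arcSol]
          rw [e]
          have hg := hγ i j
          field_simp
          linarith
      have hxe : ∀ i, ¬ Odd (l i) → x (c i 1) = 0 := by
        intro i hi
        obtain ⟨i', hi'⟩ := hnext i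
        have := (hxj i (l i) le_rfl).2
        rw [hi', hx0] at this
        rw [Nat.not_odd_iff_even, even_iff_two_dvd] at hi
        obtain ⟨r, hr⟩ := hi
        have hne : z i (l i + 1) ≠ 0 := by
          rw [hr]; exact arcSol_odd _ _ (hβ i) (hγ i) r
        simpa [hne] using this.symm
      have hxX : X (fun i => x (c i 1), fun w => x (Φ (Sum.inr w))) = x := by
        ext v
        obtain ⟨s, rfl⟩ := Φ.surjective v
        rcases s with ⟨i, j⟩ | w
        · rw [hΦ, hXc _ _ _ (by omega), (hxj i j (by omega)).1]
          by_cases ho : Odd (l i)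
          · simp [T, ho]
          · simp [T, ho, hxe i ho]
        · rw [hXw]
      refine ⟨_, ?_, hxX⟩
      ext i
      rw [hN, hxX, hx]; rfl
    · rintro ⟨ty, hty, rfl⟩
      ext v
      obtain ⟨s, rfl⟩ := Φ.surjective v
      rcases s with ⟨i, j, hj⟩ | w
      · rw [hΦ]
        rcases j with _ | j
        · exact congrFun hty i
        · simp only
          rw [hrowI i j (by omega), hXc' _ _ _ (by omega), hXc' _ _ _ (by omega)]
          have e : z i (j + 2) = - (β i j / γ i j) * z i j := by simp [hz, arcSol]
          rw [e]
          have hg := hγ i j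
          simp only [Pi.zero_apply]
          field_simp
          ring
      · rw [hrowP, hX0, mul_zero]; rfl
  have hNsurj : Function.Surjective N := by
    choose p hp using hpar
    intro y
    refine ⟨(0, fun w => if w = p (par w) then y (par w) / A (c (par w) 0) (Φ (Sum.inr w)) else 0), ?_⟩
    ext i
    rw [hN, Matrix.mulVec, dotProduct, ← Φ.sum_comp, Fintype.sum_sum_type]
    rw [Finset.sum_eq_zero, zero_add, Finset.sum_eq_single (p i)]
    · rw [hXw]
      have := hmajne (p i)
      simp only [hp] at this ⊢
      simp
      field_simp
    · intro w _ hw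
      rw [hXw]
      by_cases h : par w = i
      · simp [h, hw]
      · rw [hmajz _ _ h, zero_mul]
    · simp
    · rintro ⟨i, j⟩ _
      rw [hΦ, hXc _ _ _ (by omega)]
      simp [T]
  have r1 := LinearMap.finrank_range_add_finrank_ker N
  rw [LinearMap.range_eq_top.mpr hNsurj, finrank_top] at r1
  have r2 := LinearMap.finrank_range_add_finrank_ker A.mulVecLin
  rw [hker, ← (Submodule.equivMapOfInjective X hXinj (LinearMap.ker N)).finrank_eq] at r2
  have r3 := Fintype.card_congr Φ
  simp only [Fintype.card_sum, Fintype.card_sigma, Fintype.card_fin] at r3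
  simp only [Module.finrank_prod, Module.finrank_fintype_fun_eq_card] at r1 r2
  rw [Matrix.rank]
  omega

/-- For a canonical signed unicyclic graph `Γ` (adjacency matrix `A` over
the underlying graph `G`) with girth `g ≡ 0, 2 (mod 4)`, whose unique cycle is
parametrized by `f : ZMod g → V`, which is not itself a cycle, with major vertices at
positions `a 0 < a 1 < ⋯ < a (k-1)` along the cycle and `l i` vertices strictly between
consecutive major vertices (so that `g = k + ∑ l i`):
`i₋(Γ) = ⌈g/2⌉ + 1` iff exactly two of the `l i` are even. -/
theorem stmt_2 {V : Type} [Fintype V] [DecidableEq V]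
    (G : SimpleGraph V) (A : Matrix V V ℝ) (hA : A.IsHermitian)
    (hone : ∀ u v, G.Adj u v → A u v = 1 ∨ A u v = -1)
    (hzero : ∀ u v, ¬ G.Adj u v → A u v = 0)
    (g : ℕ) (hgirth : G.girth = (g : ℕ∞)) (hmod : g % 4 = 0 ∨ g % 4 = 2)
    (f : ZMod g → V) (hfinj : Function.Injective f)
    (hcyc : ∀ m : ZMod g, G.Adj (f m) (f (m + 1)))
    (hpend : ∀ v, v ∉ Set.range f → ∃! u, u ∈ Set.range f ∧ G.Adj v u)
    (hind : ∀ v w, v ∉ Set.range f → w ∉ Set.range f → ¬ G.Adj v w)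
    (hnotcycle : ∃ v, v ∉ Set.range f)
    (k : ℕ) (hk : 1 ≤ k)
    (a : Fin k → ℕ) (ha : StrictMono a) (halt : ∀ i, a i < g)
    (hmaj : ∀ m : ZMod g,
      ((∃ w, w ∉ Set.range f ∧ G.Adj (f m) w) ↔ ∃ i : Fin k, m = (a i : ZMod g)))
    (l : Fin k → ℕ)
    (hl : ∀ i : Fin k, ∀ h : (i : ℕ) + 1 < k, a ⟨(i : ℕ) + 1, h⟩ = a i + l i + 1)
    (hlast : g + a ⟨0, by omega⟩ = a ⟨k - 1, by omega⟩ + l ⟨k - 1, by omega⟩ + 1)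
    (hsum : g = k + (∑ i, l i)) :
    negInertia hA = (g + 1) / 2 + 1 ↔
      (Finset.univ.filter fun i => Even (l i)).card = 2 := by
  classical
  have hgirth' : G.girth = g := by exact_mod_cast hgirth
  have hg0 : g ≠ 0 := by
    rintro rfl
    have : Finite (ZMod 0) := Finite.of_injective f hfinj
    exact (not_finite_iff_infinite.mpr (inferInstanceAs (Infinite ℤ))) this
  have hg3 : 3 ≤ g := by
    rw [← hgirth']
    apply SimpleGraph.three_le_girth
    rw [← SimpleGraph.girth_eq_zero]
    omega
  have : NeZero g := ⟨hg0⟩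
  have hne0 : ∀ u v, G.Adj u v → A u v ≠ 0 := by
    intro u v h
    rcases hone u v h with h | h <;> rw [h] <;> norm_num
  have hchord := chordless G g hg3 hgirth' f hfinj hcyc
  -- the attaching position of a pendant vertex
  have hnb : ∀ w : {v // v ∉ Set.range f}, ∃ m : ZMod g, G.Adj w.1 (f m) ∧
      ∀ m', G.Adj w.1 (f m') → m' = m := by
    rintro ⟨w, hw⟩
    obtain ⟨u, ⟨⟨m, rfl⟩, h1⟩, h2⟩ := hpend w hw
    exact ⟨m, h1, fun m' h' => hfinj (h2 (f m') ⟨⟨m', rfl⟩, h'⟩)⟩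
  choose nb hnb1 hnb2 using hnb
  let Ψ : ZMod g ⊕ {v // v ∉ Set.range f} ≃ V :=
    ((Equiv.ofInjective f hfinj).sumCongr (Equiv.refl _)).trans (Equiv.Set.sumCompl (Set.range f))
  have hΨl : ∀ m, Ψ (Sum.inl m) = f m := fun m => rfl
  have hΨr : ∀ w, Ψ (Sum.inr w) = w.1 := fun w => rfl
  -- bipartite signature
  let s : ZMod g → ℝ := fun m =>
    if ZMod.castHom (show 2 ∣ g by omega) (ZMod 2) m = 0 then 1 else -1
  have hs2 : ∀ m, s m * s m = 1 := by
    intro m; simp only [s]; split_ifs <;> norm_num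
  have hs1 : ∀ m, s (m + 1) = - s m := by
    intro m
    simp only [s, map_add, map_one]
    generalize (ZMod.castHom (show 2 ∣ g by omega) (ZMod 2)) m = y
    by_cases hy : y = 0
    · rw [if_pos hy, if_neg (fun h => (zmod_two_succ y).mp h hy)]
    · rw [if_neg hy, if_pos ((zmod_two_succ y).mpr hy), neg_neg]
  have hs1' : ∀ m, s (m - 1) = - s m := by
    intro m
    have := hs1 (m - 1)
    rw [sub_add_cancel] at this
    linarith
  let d : V → ℝ := fun v => Sum.elim s (fun w => - s (nb w)) (Ψ.symm v)
  have hrank := two_negInertia_eq_rank A hA d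
    (by
      intro v
      simp only [d]
      rcases Ψ.symm v with m | w
      · exact hs2 m
      · simpa using hs2 (nb w))
    (by
      intro u v huv
      have hadj : G.Adj u v := by
        by_contra h
        exact huv (hzero u v h)
      obtain ⟨p, rfl⟩ := Ψ.surjective u
      obtain ⟨q, rfl⟩ := Ψ.surjective v
      simp only [d, Equiv.symm_apply_apply]
      rcases p with m | w <;> rcases q with n | w'
      · rw [hΨl, hΨl] at hadj
        rcases hchord m n hadj with rfl | rfl
        · simp [hs1]
        · simp [hs1']
      · rw [hΨl, hΨr] at hadj
        simp [hnb2 w' m hadj.symm]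
      · rw [hΨl, hΨr] at hadj
        simp [hnb2 w n hadj]
      · exact absurd hadj (hind _ _ w.2 w'.2))
  -- arcs
  have hnextZ : ∀ i, ∃ i', ((a i + (l i + 1) : ℕ) : ZMod g) = (a i' : ZMod g) := by
    intro i
    by_cases h : (i : ℕ) + 1 < k
    · refine ⟨⟨i + 1, h⟩, ?_⟩
      rw [hl i h, add_assoc]
    · refine ⟨⟨0, by omega⟩, ?_⟩
      have h1 : i = ⟨k - 1, by omega⟩ := by
        ext; simp; omega
      have h2 : a i + (l i + 1) = g + a ⟨0, by omega⟩ := by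
        rw [hlast, ← add_assoc]
        congr 2 <;> rw [h1]
      rw [h2]
      simp
  let e : ((i : Fin k) × Fin (l i + 1)) → ZMod g := fun s => ((a s.1 + s.2 : ℕ) : ZMod g)
  have hesurj : Function.Surjective e := by
    have key : ∀ n : ℕ, ∃ s, e s = (a ⟨0, by omega⟩ : ZMod g) + n := by
      intro n
      induction n with
      | zero => exact ⟨⟨⟨0, by omega⟩, 0⟩, by simp [e]⟩
      | succ n ih =>
        obtain ⟨⟨i, j, hj⟩, h⟩ := ih
        simp only [e] at h
        by_cases hj' : j + 1 < l i + 1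
        · refine ⟨⟨i, j + 1, hj'⟩, ?_⟩
          simp only [e]
          push_cast at h ⊢
          rw [← add_assoc, h]; ring
        · have : j = l i := by omega
          subst this
          obtain ⟨i', hi'⟩ := hnextZ i
          refine ⟨⟨i', 0⟩, ?_⟩
          simp only [e]
          push_cast at h hi' ⊢
          rw [← hi', ← add_assoc, h]; simp; ring
    intro m
    obtain ⟨s, h⟩ := key (m - (a ⟨0, by omega⟩ : ZMod g)).val
    refine ⟨s, ?_⟩
    rw [h, ZMod.natCast_zmod_val]; ring
  have hcard : ∑ i, (l i + 1) = g := by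
    rw [Finset.sum_add_distrib]; simp; omega
  have hebij : Function.Bijective e := by
    rw [Fintype.bijective_iff_surjective_and_card]
    refine ⟨hesurj, ?_⟩
    simp only [ZMod.card, Fintype.card_sigma, Fintype.card_fin, hcard]
  let E := Equiv.ofBijective e hebij
  have hpar : ∀ w : {v // v ∉ Set.range f}, ∃ i : Fin k, nb w = (a i : ZMod g) := by
    intro w
    exact (hmaj (nb w)).mp ⟨w.1, w.2, (hnb1 w).symm⟩
  choose par hpar using hpar
  have hnonmaj : ∀ i j, j + 1 ≤ l i → ¬ ∃ w, w ∉ Set.range f ∧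
      G.Adj (f ((a i + (j + 1) : ℕ) : ZMod g)) w := by
    intro i j hj h
    obtain ⟨i', hi'⟩ := (hmaj _).mp h
    have : e ⟨i, ⟨j + 1, by omega⟩⟩ = e ⟨i', 0⟩ := by
      simp only [e]; rw [hi']; simp
    have := hebij.1 this
    rw [Sigma.mk.injEq] at this
    obtain ⟨rfl, h2⟩ := this
    have h2 := congrArg Fin.val (eq_of_heq h2)
    simp at h2
  have hainj : ∀ i i', (a i : ZMod g) = (a i' : ZMod g) → i = i' := fun i i' h =>
    ha.injective (zmod_cast_inj (halt i) (halt i') h)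
  have hcc : ∀ i j, G.Adj (f ((a i + j : ℕ) : ZMod g)) (f ((a i + (j + 1) : ℕ) : ZMod g)) := by
    intro i j
    have := hcyc ((a i + j : ℕ) : ZMod g)
    rw [← add_assoc]
    push_cast at this ⊢
    exact this
  have main := rank_arcs A l (fun i j => f ((a i + j : ℕ) : ZMod g))
    ((E.sumCongr (Equiv.refl {v // v ∉ Set.range f})).trans Ψ)
    (fun i j => by
      simp only [Equiv.trans_apply, Equiv.sumCongr_apply, Sum.map_inl, hΨl]; rfl)
    (fun i => by
      obtain ⟨i', h⟩ := hnextZ i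
      exact ⟨i', by simp only [h, add_zero]⟩)
    par
    (fun i => by
      obtain ⟨w, hw, hadj⟩ := (hmaj (a i : ZMod g)).mpr ⟨i, rfl⟩
      refine ⟨⟨w, hw⟩, ?_⟩
      apply hainj
      rw [← hpar ⟨w, hw⟩, ← hnb2 ⟨w, hw⟩ _ hadj.symm])
    (fun w => A w.1 (f (nb w)))
    (fun w => hne0 _ _ (hnb1 w))
    (fun w x => by
      simp only [Equiv.trans_apply, Equiv.sumCongr_apply, Sum.map_inr, hΨr, Equiv.refl_apply]
      rw [Matrix.mulVec, dotProduct, Finset.sum_eq_single (f (nb w)), hpar w, add_zero]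
      · intro v _ hv
        rw [hzero, zero_mul]
        intro hadj
        by_cases hvr : v ∈ Set.range f
        · obtain ⟨m, rfl⟩ := hvr
          exact hv (by rw [hnb2 w m hadj])
        · exact hind _ _ w.2 hvr hadj
      · simp)
    (fun i j => A (f ((a i + (j + 1) : ℕ) : ZMod g)) (f ((a i + j : ℕ) : ZMod g)))
    (fun i j => A (f ((a i + (j + 1) : ℕ) : ZMod g)) (f ((a i + (j + 2) : ℕ) : ZMod g)))
    (fun i j => hne0 _ _ (hcc i j).symm)
    (fun i j => hne0 _ _ (hcc i (j + 1)))
    (fun i j hj x => by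
      have hd1 : f ((a i + j : ℕ) : ZMod g) ≠ f ((a i + (j + 2) : ℕ) : ZMod g) := by
        intro h
        have h := hfinj h
        push_cast at h
        have h2 : ((0 : ℕ) : ZMod g) = ((2 : ℕ) : ZMod g) := by
          push_cast
          linear_combination h
        have := zmod_cast_inj (by omega) (by omega) h2
        omega
      rw [Matrix.mulVec, dotProduct, Finset.sum_eq_add _ _ hd1]
      · intro v _ hv
        rw [hzero, zero_mul]
        intro hadj
        by_cases hvr : v ∈ Set.range f
        · obtain ⟨m, rfl⟩ := hvr
          rcases hchord _ _ hadj with h | h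
          · apply hv.2
            rw [h]; congr 1; push_cast; ring
          · apply hv.1
            rw [h]; congr 1; push_cast; ring
        · exact hnonmaj i j hj ⟨v, hvr, hadj⟩
      · simp
      · simp)
    (fun w => by
      simp only [Equiv.trans_apply, Equiv.sumCongr_apply, Sum.map_inr, hΨr, Equiv.refl_apply]
      rw [add_zero, ← hpar w]
      exact hne0 _ _ (hnb1 w).symm)
    (fun i w hw => by
      simp only [Equiv.trans_apply, Equiv.sumCongr_apply, Sum.map_inr, hΨr, Equiv.refl_apply]
      rw [add_zero]
      apply hzero
      intro hadj
      apply hw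
      apply hainj
      rw [← hpar w, ← hnb2 w _ hadj.symm])
  rw [hcard, Fintype.card_subtype, Fintype.card_fin, ← hrank] at main
  have hsplit := Finset.card_filter_add_card_filter_not (s := (Finset.univ : Finset (Fin k)))
    (fun i => Even (l i))
  simp only [Nat.not_even_iff_odd, Finset.card_univ, Fintype.card_fin] at hsplit
  omega
end

section
/- Let Γ = (G,σ) be a connected signed graph whose underlying graph G is triangle-free with girth g ≡ 2 or 3 (mod 4), and suppose Γ contains a balanced shortest cycle C of length g. If i_-(Γ) = ⌈g/2⌉ + 1, then every vertex of Γ is at distance at most 3 from V(C); that is, N_r(C) = ∅ for all r ≥ 4. -/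
/-- The distance from a vertex `v` to the vertex set of the cycle parametrized by
`f : ZMod g → V`: the minimum over `m` of `dist v (f m)`. -/
noncomputable def distToCycle {V : Type} (G : SimpleGraph V) {g : ℕ}
    (f : ZMod g → V) (v : V) : ℕ :=
  sInf {d : ℕ | ∃ m : ZMod g, G.dist v (f m) = d}




theorem aux_inertia {n : Type} [Fintype n] [DecidableEq n]
    {A : Matrix n n ℝ} (hA : A.IsHermitian) {E : Type} [AddCommGroup E] [Module ℝ E]
    [FiniteDimensional ℝ E] (φ : E →ₗ[ℝ] (n → ℝ))
    (h : ∀ y, y ≠ 0 → φ y ⬝ᵥ A.mulVec (φ y) < 0) :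
    Module.finrank ℝ E ≤ (Finset.univ.filter fun i => hA.eigenvalues i < 0).card := by
  set U : Matrix n n ℝ := (hA.eigenvectorUnitary : Matrix n n ℝ) with hU
  have key : ∀ x : n → ℝ, x ⬝ᵥ A.mulVec x =
      ∑ i, hA.eigenvalues i * (U.transpose.mulVec x i) ^ 2 := by
    intro x
    have hs : A = U * Matrix.diagonal hA.eigenvalues * U.transpose := by
      have := hA.spectral_theorem
      rw [Unitary.conjStarAlgAut_apply] at this
      exact this
    conv_lhs => rw [hs]
    rw [← Matrix.mulVec_mulVec, ← Matrix.mulVec_mulVec, Matrix.dotProduct_mulVec,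
      ← Matrix.mulVec_transpose]
    simp only [dotProduct, Matrix.mulVec_diagonal]
    exact Finset.sum_congr rfl fun i _ => by ring
  let ψ : E →ₗ[ℝ] ({i // hA.eigenvalues i < 0} → ℝ) :=
    (LinearMap.funLeft ℝ ℝ Subtype.val) ∘ₗ (U.transpose.mulVecLin) ∘ₗ φ
  have hinj : Function.Injective ψ := by
    rw [← LinearMap.ker_eq_bot, LinearMap.ker_eq_bot']
    intro y hy
    by_contra hne
    have h1 := h y hne
    rw [key] at h1
    refine absurd h1 (not_lt.2 (Finset.sum_nonneg fun i _ => ?_))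
    by_cases hi : hA.eigenvalues i < 0
    · have : U.transpose.mulVec (φ y) i = 0 := congrFun hy ⟨i, hi⟩
      simp [this]
    · exact mul_nonneg (not_lt.1 hi) (sq_nonneg _)
  have := LinearMap.finrank_le_finrank_of_injective hinj
  rwa [Module.finrank_fintype_fun_eq_card, Fintype.card_subtype] at this

theorem aux_cycle_step (m k : ℕ) (H : ∃ (E : Type) (_ : AddCommGroup E) (_ : Module ℝ E) (_ : FiniteDimensional ℝ E)
    (φ : ℕ → E →ₗ[ℝ] ℝ), Module.finrank ℝ E = k ∧
      ∀ y, y ≠ 0 → ∑ i ∈ Finset.range m, φ i y * φ (i+1) y + φ m y * φ 0 y < 0) :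
    ∃ (E : Type) (_ : AddCommGroup E) (_ : Module ℝ E) (_ : FiniteDimensional ℝ E)
    (φ : ℕ → E →ₗ[ℝ] ℝ), Module.finrank ℝ E = k + 2 ∧
      ∀ y, y ≠ 0 → ∑ i ∈ Finset.range (m+4), φ i y * φ (i+1) y + φ (m+4) y * φ 0 y < 0 := by
  obtain ⟨E, _, _, _, φ, hk, hφ⟩ := H
  let P : (E × ℝ × ℝ) →ₗ[ℝ] E := LinearMap.fst ℝ _ _
  let u : (E × ℝ × ℝ) →ₗ[ℝ] ℝ := LinearMap.fst ℝ _ _ ∘ₗ LinearMap.snd ℝ _ _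
  let p : (E × ℝ × ℝ) →ₗ[ℝ] ℝ := LinearMap.snd ℝ _ _ ∘ₗ LinearMap.snd ℝ _ _
  let z := φ m ∘ₗ P
  let w := φ 0 ∘ₗ P
  let φ' : ℕ → (E × ℝ × ℝ) →ₗ[ℝ] ℝ := fun i =>
    if i ≤ m then φ i ∘ₗ P else if i = m+1 then u + p + w else if i = m+2 then -u - z
      else if i = m+3 then -p - w else p + z
  refine ⟨E × ℝ × ℝ, inferInstance, inferInstance, inferInstance, φ', ?_, ?_⟩
  · simp [hk]
  · rintro ⟨y, a, b⟩ hy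
    have e0 : ∀ i, i ≤ m → φ' i (y, a, b) = φ i y := by
      intro i hi
      simp [φ', hi, P]
    have e1 : φ' (m+1) (y, a, b) = a + b + φ 0 y := by simp [φ', u, p, w, P]
    have e2 : φ' (m+2) (y, a, b) = -a - φ m y := by simp [φ', u, z, P]
    have e3 : φ' (m+3) (y, a, b) = -b - φ 0 y := by simp [φ', p, w, P]
    have e4 : φ' (m+4) (y, a, b) = b + φ m y := by simp [φ', p, z, P]
    rw [Finset.sum_range_succ, Finset.sum_range_succ, Finset.sum_range_succ, Finset.sum_range_succ]
    rw [Finset.sum_congr rfl (g := fun i => φ i y * φ (i+1) y) (by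
      intro i hi
      have := Finset.mem_range.1 hi
      rw [e0 i (by omega), e0 (i+1) (by omega)])]
    simp only [add_assoc, Nat.reduceAdd]
    rw [e0 m le_rfl, e0 0 (Nat.zero_le _), e1, e2, e3, e4]
    by_cases h0 : y = 0
    · subst h0
      have : a ≠ 0 ∨ b ≠ 0 := by
        by_contra hc
        push Not at hc
        exact hy (by simp [hc.1, hc.2])
      simp only [map_zero, mul_zero, Finset.sum_const_zero]
      rcases this with h | h <;> have := sq_pos_of_ne_zero h <;>
        nlinarith [sq_nonneg a, sq_nonneg b]
    · have := hφ y h0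
      nlinarith [sq_nonneg a, sq_nonneg b]

theorem aux_cycle (t : ℕ) : ∀ n, n = 4 * t + 2 ∨ n = 4 * t + 3 →
    ∃ (E : Type) (_ : AddCommGroup E) (_ : Module ℝ E) (_ : FiniteDimensional ℝ E)
    (φ : ℕ → E →ₗ[ℝ] ℝ), Module.finrank ℝ E = (n + 1) / 2 ∧
      ∀ y, y ≠ 0 → ∑ i ∈ Finset.range (n-1), φ i y * φ (i+1) y + φ (n-1) y * φ 0 y < 0 := by
  induction t with
  | zero =>
    rintro n (rfl | rfl)
    · refine ⟨ℝ, inferInstance, inferInstance, inferInstance,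
        fun i => if i = 0 then LinearMap.id else -LinearMap.id, by simp, ?_⟩
      intro y hy
      have := sq_pos_of_ne_zero hy
      simp
      nlinarith
    · refine ⟨ℝ × ℝ, inferInstance, inferInstance, inferInstance,
        fun i => if i = 0 then LinearMap.fst ℝ _ _ else if i = 1 then LinearMap.snd ℝ _ _
          else -LinearMap.fst ℝ _ _ - LinearMap.snd ℝ _ _, by simp, ?_⟩
      rintro ⟨a, b⟩ hy
      have : a ≠ 0 ∨ b ≠ 0 := by
        by_contra hc
        push Not at hc
        exact hy (by simp [hc.1, hc.2])
      simp [Finset.sum_range_succ]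
      rcases this with h | h <;> have := sq_pos_of_ne_zero h <;>
        nlinarith [sq_nonneg a, sq_nonneg b, sq_nonneg (a + b)]
  | succ t ih =>
    intro n hn
    obtain ⟨n, rfl⟩ : ∃ k, n = k + 4 := ⟨n - 4, by omega⟩
    have := aux_cycle_step _ _ (ih n (by omega))
    rw [show n + 4 - 1 = n - 1 + 4 by omega, show (n + 4 + 1) / 2 = (n+1)/2 + 2 by omega]
    exact this

theorem aux_path {V : Type} (G : SimpleGraph V) {g : ℕ} (f : ZMod g → V)
    (hfinj : Function.Injective f) (hcyc : ∀ m : ZMod g, G.Adj (f m) (f (m + 1)))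
    (i : ZMod g) (d : ℕ) (hd : d < g) :
    ∃ p : G.Walk (f i) (f (i + d)), p.length = d ∧ p.IsPath ∧
      ∀ x ∈ p.support, ∃ k : ℕ, k ≤ d ∧ x = f (i + k) := by
  induction d with
  | zero =>
    have h : f i = f (i + (0 : ℕ)) := by simp
    refine ⟨SimpleGraph.Walk.nil.copy rfl h, by simp, by simp, ?_⟩
    intro x hx
    simp at hx
    exact ⟨0, le_rfl, by simp [hx]⟩
  | succ d ih =>
    obtain ⟨p, hl, hp, hs⟩ := ih (by omega)
    have hadj : G.Adj (f (i + d)) (f (i + ((d + 1 : ℕ) : ZMod g))) := by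
      have := hcyc (i + d)
      rw [add_assoc] at this
      simpa using this
    refine ⟨p.concat hadj, by simp [hl], hp.concat ?_ hadj, ?_⟩
    · intro hx
      obtain ⟨k, hk, he⟩ := hs _ hx
      have := add_left_cancel (hfinj he)
      rw [ZMod.natCast_eq_natCast_iff'] at this
      rw [Nat.mod_eq_of_lt hd, Nat.mod_eq_of_lt (by omega)] at this
      omega
    · intro x hx
      rw [SimpleGraph.Walk.support_concat] at hx
      simp only [List.mem_append, List.mem_singleton] at hx
      rcases hx with hx | hx
      · obtain ⟨k, hk, he⟩ := hs _ hx
        exact ⟨k, by omega, he⟩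
      · exact ⟨d + 1, le_rfl, hx⟩

theorem aux_close {V : Type} (G : SimpleGraph V) {u v : V} (p : G.Walk u v) (hp : p.IsPath)
    (hl : 2 ≤ p.length) (h : G.Adj v u) : G.girth ≤ p.length + 1 := by
  have hc : (SimpleGraph.Walk.cons h p).IsCycle := by
    rw [SimpleGraph.Walk.cons_isCycle_iff]
    refine ⟨hp, fun hm => ?_⟩
    rw [Sym2.eq_swap] at hm
    have := hp.length_eq_one_of_mem_edges hm
    omega
  simpa using hc.isCircuit.girth_le_length

theorem aux_chord {V : Type} (G : SimpleGraph V) {g : ℕ} (hg : 6 ≤ g) (hgirth : G.girth = g)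
    (f : ZMod g → V) (hfinj : Function.Injective f) (hcyc : ∀ m : ZMod g, G.Adj (f m) (f (m + 1)))
    (i j : ZMod g) (h : G.Adj (f i) (f j)) : j = i + 1 ∨ j = i - 1 := by
  have : NeZero g := ⟨by omega⟩
  have hj : j = i + (((j - i).val : ℕ) : ZMod g) := by simp
  have hlt := ZMod.val_lt (j - i)
  generalize (j - i).val = d at hj hlt
  subst hj
  obtain ⟨p, hl, hp, -⟩ := aux_path G f hfinj hcyc i d hlt
  have h0 : d ≠ 0 := by
    rintro rfl
    simp at h
  by_cases h1 : d = 1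
  · left; simp [h1]
  by_cases h2 : d = g - 1
  · right
    have : ((d : ℕ) : ZMod g) + 1 = 0 := by
      have : ((d + 1 : ℕ) : ZMod g) = 0 := by
        rw [show d + 1 = g by omega]; simp
      simpa using this
    rw [sub_eq_add_neg, eq_neg_of_add_eq_zero_left this]
  have := aux_close G p hp (by omega) h.symm
  omega

theorem aux_nbr' {V : Type} (G : SimpleGraph V) {g : ℕ} (hg : 6 ≤ g) (hgirth : G.girth = g)
    (f : ZMod g → V) (hfinj : Function.Injective f) (hcyc : ∀ m : ZMod g, G.Adj (f m) (f (m + 1)))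
    (x : V) (hx : ∀ i, x ≠ f i) (i j : ZMod g) (h : G.Adj x (f i)) (h' : G.Adj x (f j))
    (hne : j ≠ i) : g - 2 ≤ (j - i).val := by
  have : NeZero g := ⟨by omega⟩
  have hj : j = i + (((j - i).val : ℕ) : ZMod g) := by simp
  have hlt := ZMod.val_lt (j - i)
  generalize (j - i).val = d at hj hlt
  subst hj
  obtain ⟨p, hl, hp, hs⟩ := aux_path G f hfinj hcyc i d hlt
  have h0 : d ≠ 0 := by
    rintro rfl
    simp at hne
  have hp' : (p.concat h'.symm).IsPath := hp.concat (fun hm => by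
    obtain ⟨k, -, hk⟩ := hs _ hm
    exact hx _ hk) _
  have := aux_close G _ hp' (by simp; omega) h
  simp at this
  omega

theorem aux_nbr {V : Type} (G : SimpleGraph V) {g : ℕ} (hg : 6 ≤ g) (hgirth : G.girth = g)
    (f : ZMod g → V) (hfinj : Function.Injective f) (hcyc : ∀ m : ZMod g, G.Adj (f m) (f (m + 1)))
    (x : V) (hx : ∀ i, x ≠ f i) (i j : ZMod g) (h : G.Adj x (f i)) (h' : G.Adj x (f j)) :
    j = i := by
  by_contra hne
  have : NeZero g := ⟨by omega⟩
  have h1 := aux_nbr' G hg hgirth f hfinj hcyc x hx i j h h' hne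
  have h2 := aux_nbr' G hg hgirth f hfinj hcyc x hx j i h' h (Ne.symm hne)
  have h3 : (i - j).val = g - (j - i).val := by
    have : NeZero (j - i) := ⟨sub_ne_zero.2 hne⟩
    rw [← neg_sub, ZMod.val_neg_of_ne_zero]
  omega

theorem aux_sum {g : ℕ} [NeZero g] (F : ZMod g → ℝ) :
    ∑ i : ZMod g, F i = ∑ i ∈ Finset.range g, F (i : ZMod g) := by
  refine Finset.sum_nbij' (fun i => i.val) (fun k => (k : ZMod g)) ?_ ?_ ?_ ?_ ?_
  · intro a _; exact Finset.mem_range.2 (ZMod.val_lt a)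
  · intro a _; simp
  · intro a _; simp
  · intro a ha; exact ZMod.val_cast_of_lt (Finset.mem_range.1 ha)
  · intro a _; simp

theorem aux_geod {V : Type} (G : SimpleGraph V) (hconn : G.Connected) {g : ℕ} [NeZero g]
    (f : ZMod g → V) (v : V) (hv : 4 ≤ sInf {d : ℕ | ∃ m : ZMod g, G.dist v (f m) = d}) :
    ∃ (m : ZMod g) (w : ℕ → V), w 0 = f m ∧ (∀ k, k < 4 → G.Adj (w k) (w (k+1))) ∧
      (∀ k, k ≤ 4 → ∀ i, k ≤ G.dist (w k) (f i)) ∧ (∀ k, k ≤ 4 → G.dist (w k) (f m) ≤ k) := by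
  set S := {d : ℕ | ∃ m : ZMod g, G.dist v (f m) = d}
  obtain ⟨m, hm⟩ : sInf S ∈ S := Nat.sInf_mem ⟨_, 0, rfl⟩
  have hmin : ∀ i, sInf S ≤ G.dist v (f i) := fun i => Nat.sInf_le ⟨i, rfl⟩
  obtain ⟨p, hp⟩ := hconn.exists_walk_length_eq_dist (f m) v
  rw [SimpleGraph.dist_comm] at hm
  refine ⟨m, p.getVert, by simp, fun k hk => p.adj_getVert_succ (by omega), fun k hk i => ?_,
    fun k hk => ?_⟩
  · have h1 := SimpleGraph.dist_le (p.drop k)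
    rw [SimpleGraph.Walk.drop_length] at h1
    have h2 := hconn.dist_triangle (u := v) (v := p.getVert k) (w := f i)
    have h3 := hmin i
    rw [SimpleGraph.dist_comm] at h1
    omega
  · have h1 := SimpleGraph.dist_le (p.take k)
    rw [SimpleGraph.Walk.take_length] at h1
    rw [SimpleGraph.dist_comm] at h1
    omega

theorem aux_form {V : Type} [Fintype V] [DecidableEq V] (G : SimpleGraph V)
    (A : Matrix V V ℝ) (hA : A.IsHermitian)
    (hzero : ∀ u v, ¬ G.Adj u v → A u v = 0) {g : ℕ} (hg : 6 ≤ g) [NeZero g]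
    (f : ZMod g → V)
    (hch : ∀ i j, G.Adj (f i) (f j) → j = i + 1 ∨ j = i - 1) (c : ZMod g → ℝ) :
    (∑ i, c i • (Pi.single (f i) 1 : V → ℝ)) ⬝ᵥ
      A.mulVec (∑ i, c i • (Pi.single (f i) 1 : V → ℝ)) =
    2 * ∑ i, c i * c (i + 1) * A (f i) (f (i + 1)) := by
  have hsym : ∀ u v, A u v = A v u := fun u v => by simpa using hA.apply v u
  have e1 : ∀ i, ∑ j, c i * c j * A (f i) (f j) =
      c i * c (i+1) * A (f i) (f (i+1)) + c i * c (i-1) * A (f i) (f (i-1)) := by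
    intro i
    have hne : i + 1 ≠ i - 1 := by
      intro h
      have h2 : ((2 : ℕ) : ZMod g) = 0 := by
        push_cast
        linear_combination h
      rw [ZMod.natCast_eq_zero_iff] at h2
      have := Nat.le_of_dvd (by norm_num) h2
      omega
    rw [← Finset.sum_pair (f := fun j => c i * c j * A (f i) (f j)) hne]
    symm
    apply Finset.sum_subset (Finset.subset_univ _)
    intro j _ hj
    simp only [Finset.mem_insert, Finset.mem_singleton] at hj
    rw [hzero _ _ (fun h => hj (hch i j h)), mul_zero]
  have e2 : ∑ i, c i * c (i-1) * A (f i) (f (i-1)) = ∑ i, c i * c (i+1) * A (f i) (f (i+1)) := by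
    rw [← Equiv.sum_comp (Equiv.addRight (1 : ZMod g))]
    refine Finset.sum_congr rfl fun i _ => ?_
    simp only [Equiv.coe_addRight, add_sub_cancel_right]
    rw [hsym (f (i+1))]
    ring
  calc _ = ∑ i, ∑ j, c i * c j * A (f i) (f j) := by
        rw [Matrix.mulVec_sum, sum_dotProduct]
        refine Finset.sum_congr rfl fun i _ => ?_
        rw [dotProduct_sum]
        refine Finset.sum_congr rfl fun j _ => ?_
        simp [Matrix.mulVec_smul]
        ring
    _ = _ := by
        simp_rw [e1]
        rw [Finset.sum_add_distrib, e2]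
        ring

theorem aux_switch (m : ℕ) (a : ℕ → ℝ) (ha : ∀ i, a i = 1 ∨ a i = -1)
    (hprod : ∏ i ∈ Finset.range (m+1), a i = 1) (x : ℕ → ℝ) (c : ZMod (m+1) → ℝ)
    (hc : ∀ i, c i = (∏ j ∈ Finset.range i.val, a j) * x i.val) :
    ∑ i ∈ Finset.range (m+1), c (i : ZMod (m+1)) * c ((i : ZMod (m+1)) + 1) * a i =
      ∑ i ∈ Finset.range m, x i * x (i+1) + x m * x 0 := by
  have hsq : ∀ k, (∏ j ∈ Finset.range k, a j) ^ 2 = 1 := by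
    intro k
    rw [← Finset.prod_pow]
    exact Finset.prod_eq_one fun i _ => by rcases ha i with h | h <;> simp [h]
  rw [Finset.sum_range_succ]
  congr 1
  · refine Finset.sum_congr rfl fun i hi => ?_
    have hi := Finset.mem_range.1 hi
    have v1 : (i : ZMod (m+1)).val = i := ZMod.val_cast_of_lt (by omega)
    have v2 : ((i : ZMod (m+1)) + 1).val = i + 1 := by
      have := ZMod.val_cast_of_lt (n := m+1) (a := i+1) (by omega)
      rwa [Nat.cast_add, Nat.cast_one] at this
    rw [hc, hc, v1, v2, Finset.prod_range_succ]
    have h2 : a i ^ 2 = 1 := by rcases ha i with h | h <;> simp [h]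
    have h1 := hsq i
    linear_combination (x i * x (i+1) * a i ^ 2) * h1 + x i * x (i+1) * h2
  · have v1 : (m : ZMod (m+1)).val = m := ZMod.val_cast_of_lt (by omega)
    have v2 : ((m : ZMod (m+1)) + 1) = 0 := by
      have : ((m + 1 : ℕ) : ZMod (m+1)) = 0 := by simp
      rwa [Nat.cast_add, Nat.cast_one] at this
    rw [v2, hc, hc, v1, ZMod.val_zero]
    rw [Finset.prod_range_succ] at hprod
    simp only [Finset.range_zero, Finset.prod_empty]
    linear_combination x m * x 0 * hprod

theorem aux_expand {V : Type} [Fintype V] [DecidableEq V]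
    (A : Matrix V V ℝ) (hsym : ∀ u v, A u v = A v u) (z : V → ℝ) (v1 v2 v3 v4 : V)
    (x1 x2 x3 x4 b : ℝ)
    (z1 : A.mulVec z v1 = b) (z2 : A.mulVec z v2 = 0) (z3 : A.mulVec z v3 = 0)
    (z4 : A.mulVec z v4 = 0)
    (d1 : A v1 v1 = 0) (d2 : A v2 v2 = 0) (d3 : A v3 v3 = 0) (d4 : A v4 v4 = 0)
    (h13 : A v1 v3 = 0) (h14 : A v1 v4 = 0) (h24 : A v2 v4 = 0) :
    (z + x1 • (Pi.single v1 1 : V → ℝ) + x2 • (Pi.single v2 1 : V → ℝ)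
      + x3 • (Pi.single v3 1 : V → ℝ) + x4 • (Pi.single v4 1 : V → ℝ)) ⬝ᵥ
      A.mulVec (z + x1 • (Pi.single v1 1 : V → ℝ) + x2 • (Pi.single v2 1 : V → ℝ)
      + x3 • (Pi.single v3 1 : V → ℝ) + x4 • (Pi.single v4 1 : V → ℝ)) =
    z ⬝ᵥ A.mulVec z + 2 * (x1 * b + x1 * x2 * A v1 v2 + x2 * x3 * A v2 v3 + x3 * x4 * A v3 v4) := by
  have hc : ∀ v, z ⬝ᵥ A.col v = A.mulVec z v := by
    intro v
    simp only [dotProduct, Matrix.mulVec, Matrix.col_apply]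
    exact Finset.sum_congr rfl fun i _ => by rw [hsym v i, mul_comm]
  simp only [Matrix.mulVec_add, Matrix.mulVec_smul, add_dotProduct, dotProduct_add,
    smul_dotProduct, dotProduct_smul, Matrix.mulVec_single_one, single_one_dotProduct,
    Matrix.col_apply, hc, z1, z2, z3, z4, d1, d2, d3, d4, h13, h14, h24, hsym v2 v1, hsym v3 v1,
    hsym v4 v1, hsym v3 v2, hsym v4 v2, hsym v4 v3, smul_eq_mul]
  ring

/-- For a connected triangle-free signed graph `Γ` (adjacency matrix `A`
over the underlying graph `G`) with girth `g ≡ 2, 3 (mod 4)`, containing a balanced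
shortest cycle parametrized by `f : ZMod g → V`, if `i₋(Γ) = ⌈g/2⌉ + 1` then every
vertex is at distance at most `3` from the cycle. -/
theorem stmt_4 {V : Type} [Fintype V] [DecidableEq V]
    (G : SimpleGraph V) (hconn : G.Connected) (htf : G.CliqueFree 3)
    (A : Matrix V V ℝ) (hA : A.IsHermitian)
    (hone : ∀ u v, G.Adj u v → A u v = 1 ∨ A u v = -1)
    (hzero : ∀ u v, ¬ G.Adj u v → A u v = 0)
    (g : ℕ) (hgirth : G.girth = (g : ℕ∞)) (hmod : g % 4 = 2 ∨ g % 4 = 3)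
    (f : ZMod g → V) (hfinj : Function.Injective f)
    (hcyc : ∀ m : ZMod g, G.Adj (f m) (f (m + 1)))
    (hbal : ∏ i : Fin g, A (f (((i : ℕ) : ZMod g))) (f (((i : ℕ) : ZMod g) + 1)) = 1)
    (hneg : negInertia hA = (g + 1) / 2 + 1) :
    ∀ v : V, distToCycle G f v ≤ 3 := by
  by_contra hcon
  push Not at hcon
  obtain ⟨v, hv⟩ := hcon
  have hgirth' : G.girth = g := by exact_mod_cast hgirth
  have hsym : ∀ u v, A u v = A v u := fun u v => by simpa using hA.apply v u
  have hg : 6 ≤ g := by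
    have h3 : 3 ≤ G.girth := by
      apply SimpleGraph.three_le_girth
      intro hac
      rw [← SimpleGraph.girth_eq_zero] at hac
      omega
    by_contra hlt
    have : g = 3 := by omega
    subst this
    have a01 := hcyc 0
    have a12 := hcyc 1
    have a20 := hcyc 2
    rw [show (0 : ZMod 3) + 1 = 1 by decide] at a01
    rw [show (1 : ZMod 3) + 1 = 2 by decide] at a12
    rw [show (2 : ZMod 3) + 1 = 0 by decide] at a20
    exact htf {f 0, f 1, f 2} (SimpleGraph.is3Clique_triple_iff.2 ⟨a01, a20.symm, a12⟩)
  have hnz : NeZero g := ⟨by omega⟩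
  have hch := aux_chord G hg hgirth' f hfinj hcyc
  obtain ⟨m, w, hw0, hwadj, hwge, hwle⟩ := aux_geod G hconn f v hv
  have hwf : ∀ k, 2 ≤ k → k ≤ 4 → ∀ i, A (w k) (f i) = 0 := by
    intro k h2 h4 i
    refine hzero _ _ fun h => ?_
    have h1 := hwge k h4 i
    rw [SimpleGraph.dist_eq_one_iff_adj.2 h] at h1
    omega
  have hww : ∀ k l, k + 2 ≤ l → l ≤ 4 → A (w k) (w l) = 0 := by
    intro k l hkl hl
    refine hzero _ _ fun h => ?_
    have h1 := hwge l hl m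
    have h2 := hwle k (by omega)
    have h3 := hconn.dist_triangle (u := w l) (v := w k) (w := f m)
    rw [SimpleGraph.dist_eq_one_iff_adj.2 h.symm] at h3
    omega
  have hdiag : ∀ x, A x x = 0 := fun x => hzero _ _ (SimpleGraph.irrefl G)
  have hw1 : ∀ i, i ≠ m → A (w 1) (f i) = 0 := by
    intro i hi
    refine hzero _ _ fun h => hi ?_
    have h01 := hwadj 0 (by norm_num)
    rw [hw0] at h01
    refine aux_nbr G hg hgirth' f hfinj hcyc (w 1) ?_ m i h01.symm h
    intro j hj
    have := hwge 1 (by norm_num) j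
    rw [hj] at this
    simp at this
  obtain ⟨E, _, _, _, φ, hk, hφ⟩ := aux_cycle (g / 4) g (by omega)
  let a : ℕ → ℝ := fun i => A (f (i : ZMod g)) (f ((i : ZMod g) + 1))
  have ha : ∀ i, a i = 1 ∨ a i = -1 := fun i => hone _ _ (hcyc _)
  have hprod : ∏ i ∈ Finset.range g, a i = 1 := by
    rw [← hbal, ← Fin.prod_univ_eq_prod_range]
  let P : (E × ℝ × ℝ) →ₗ[ℝ] E := LinearMap.fst ℝ _ _
  let s : (E × ℝ × ℝ) →ₗ[ℝ] ℝ := LinearMap.fst ℝ _ _ ∘ₗ LinearMap.snd ℝ _ _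
  let t : (E × ℝ × ℝ) →ₗ[ℝ] ℝ := LinearMap.snd ℝ _ _ ∘ₗ LinearMap.snd ℝ _ _
  let c : ZMod g → (E × ℝ × ℝ) →ₗ[ℝ] ℝ := fun i =>
    (∏ j ∈ Finset.range i.val, a j) • (φ i.val ∘ₗ P)
  let X2 : (E × ℝ × ℝ) →ₗ[ℝ] ℝ := A (w 1) (w 2) • (s - A (w 1) (f m) • c m)
  let X4 : (E × ℝ × ℝ) →ₗ[ℝ] ℝ := A (w 3) (w 4) • (t - A (w 2) (w 3) • X2)
  let Φ : (E × ℝ × ℝ) →ₗ[ℝ] (V → ℝ) :=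
    (∑ i, (c i).smulRight (Pi.single (f i) 1 : V → ℝ)) + (-s).smulRight (Pi.single (w 1) 1)
      + X2.smulRight (Pi.single (w 2) 1) + (-t).smulRight (Pi.single (w 3) 1)
      + X4.smulRight (Pi.single (w 4) 1)
  have hΦ : ∀ y, Φ y = (∑ i, c i y • (Pi.single (f i) 1 : V → ℝ))
      + (- s y) • (Pi.single (w 1) 1 : V → ℝ) + X2 y • (Pi.single (w 2) 1 : V → ℝ)
      + (- t y) • (Pi.single (w 3) 1 : V → ℝ) + X4 y • (Pi.single (w 4) 1 : V → ℝ) := by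
    intro y
    simp only [Φ, LinearMap.add_apply, LinearMap.sum_apply, LinearMap.smulRight_apply,
      LinearMap.neg_apply]
  have hmv : ∀ (y : E × ℝ × ℝ) (u : V),
      A.mulVec (∑ i, c i y • (Pi.single (f i) 1 : V → ℝ)) u = ∑ i, c i y * A u (f i) := by
    intro y u
    rw [Matrix.mulVec_sum]
    simp [Matrix.mulVec_smul]
  have hneg' : ∀ y, y ≠ 0 → Φ y ⬝ᵥ A.mulVec (Φ y) < 0 := by
    intro y hy
    rw [hΦ, aux_expand A hsym _ (w 1) (w 2) (w 3) (w 4) _ _ _ _ (c m y * A (w 1) (f m))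
      ?_ ?_ ?_ ?_ (hdiag _) (hdiag _) (hdiag _) (hdiag _) (hww 1 3 (by norm_num) (by norm_num))
      (hww 1 4 (by norm_num) (by norm_num)) (hww 2 4 (by norm_num) (by norm_num)),
      aux_form G A hA hzero hg f hch (fun i => c i y), aux_sum]
    · have hsw : ∑ i ∈ Finset.range g, c (i : ZMod g) y * c ((i : ZMod g) + 1) y *
          A (f (i : ZMod g)) (f ((i : ZMod g) + 1)) =
          ∑ i ∈ Finset.range (g - 1), φ i y.1 * φ (i+1) y.1 + φ (g - 1) y.1 * φ 0 y.1 := by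
        obtain ⟨n, rfl⟩ : ∃ n, g = n + 1 := ⟨g - 1, by omega⟩
        exact aux_switch n a ha hprod (fun i => φ i y.1) (fun i => c i y) (fun i => rfl)
      rw [hsw]
      have sq : ∀ u v, G.Adj u v → A u v ^ 2 = 1 := fun u v h => by
        rcases hone u v h with h | h <;> simp [h]
      have q12 : A (w 1) (w 2) ^ 2 = 1 := sq _ _ (hwadj 1 (by norm_num))
      have q34 : A (w 3) (w 4) ^ 2 = 1 := sq _ _ (hwadj 3 (by norm_num))
      have hX2 : X2 y = A (w 1) (w 2) * (s y - A (w 1) (f m) * c m y) := rfl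
      have hX4 : X4 y = A (w 3) (w 4) * (t y - A (w 2) (w 3) * X2 y) := rfl
      have e1 : -s y * (c m y * A (w 1) (f m)) + -s y * X2 y * A (w 1) (w 2)
          + X2 y * -t y * A (w 2) (w 3) + -t y * X4 y * A (w 3) (w 4) = - s y ^ 2 - t y ^ 2 := by
        rw [hX4]
        have e2 : X2 y * A (w 1) (w 2) = s y - A (w 1) (f m) * c m y := by
          rw [hX2]; linear_combination (s y - A (w 1) (f m) * c m y) * q12
        linear_combination (- s y) * e2 - t y * (t y - A (w 2) (w 3) * X2 y) * q34
      rw [e1]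
      by_cases h0 : y.1 = 0
      · have : s y ≠ 0 ∨ t y ≠ 0 := by
          by_contra hc
          push Not at hc
          exact hy (Prod.ext h0 (Prod.ext hc.1 hc.2))
        simp only [h0, map_zero, mul_zero, Finset.sum_const_zero]
        rcases this with h | h <;> have := sq_pos_of_ne_zero h <;>
          nlinarith [sq_nonneg (s y), sq_nonneg (t y)]
      · have := hφ _ h0
        nlinarith [sq_nonneg (s y), sq_nonneg (t y)]
    · rw [hmv]
      exact Finset.sum_eq_single m (fun i _ hi => by rw [hw1 i hi, mul_zero]) (by simp)
    all_goals
      rw [hmv]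
      exact Finset.sum_eq_zero fun i _ => by rw [hwf _ (by norm_num) (by norm_num), mul_zero]
  have hfin := aux_inertia hA Φ hneg'
  have hd : Module.finrank ℝ (E × ℝ × ℝ) = (g + 1) / 2 + 2 := by simp [hk]
  rw [hd] at hfin
  unfold negInertia at hneg
  omega
end

section
/- Let Γ = (G,σ) be a connected signed graph whose underlying graph G is triangle-free with girth g ≡ 2 or 3 (mod 4), and suppose Γ contains a balanced shortest cycle C of length g and i_-(Γ) = ⌈g/2⌉ + 1. If some vertex of Γ is at distance exactly 3 from V(C), then exactly one vertex of Γ is at distance exactly 2 from V(C); that is, |N_2(C)| = 1. -/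
open SimpleGraph

theorem seqWalk {V : Type} (G : SimpleGraph V) (h : ℕ → V) (n : ℕ)
    (hadj : ∀ i < n, G.Adj (h i) (h (i+1)))
    (hinj : ∀ i ≤ n, ∀ j ≤ n, h i = h j → i = j) :
    ∀ k ≤ n, ∃ p : G.Walk (h 0) (h k), p.length = k ∧ p.IsPath ∧
      (∀ v ∈ p.support, ∃ i ≤ k, v = h i) ∧
      (∀ e ∈ p.edges, ∃ i < k, e = s(h i, h (i+1))) := by
  intro k
  induction k with
  | zero => intro _; exact ⟨Walk.nil, by simp⟩
  | succ k ih =>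
    intro hk
    obtain ⟨p, hl, hp, hs, he⟩ := ih (by omega)
    refine ⟨p.concat (hadj k (by omega)), by simp [hl], ?_, ?_, ?_⟩
    · apply hp.concat
      intro hmem
      obtain ⟨i, hi, e⟩ := hs _ hmem
      have := hinj _ hk _ (by omega) e
      omega
    · intro v hv
      rw [Walk.support_concat] at hv
      simp only [List.mem_append, List.mem_singleton] at hv
      rcases hv with hv | hv
      · obtain ⟨i, hi, e⟩ := hs _ hv
        exact ⟨i, by omega, e⟩
      · exact ⟨k+1, le_rfl, hv⟩
    · intro e hv
      rw [Walk.edges_concat] at hv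
      simp only [List.concat_eq_append, List.mem_append, List.mem_singleton] at hv
      rcases hv with hv | hv
      · obtain ⟨i, hi, e⟩ := he _ hv
        exact ⟨i, by omega, e⟩
      · exact ⟨k, by omega, hv⟩

theorem girth_le_seq {V : Type} (G : SimpleGraph V) (h : ℕ → V) (n : ℕ) (hn : 2 ≤ n)
    (hadj : ∀ i < n, G.Adj (h i) (h (i+1)))
    (hinj : ∀ i ≤ n, ∀ j ≤ n, h i = h j → i = j) (hc : G.Adj (h n) (h 0)) :
    G.girth ≤ n + 1 := by
  obtain ⟨p, hl, hp, hs, he⟩ := seqWalk G h n hadj hinj n le_rfl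
  have hcy : (Walk.cons hc p).IsCycle := by
    rw [Walk.cons_isCycle_iff]
    refine ⟨hp, fun hm => ?_⟩
    obtain ⟨i, hi, e⟩ := he _ hm
    rw [Sym2.eq_iff] at e
    rcases e with ⟨e, _⟩ | ⟨e1, e2⟩
    · have := hinj _ le_rfl _ (by omega) e; omega
    · have := hinj _ le_rfl _ (by omega) e1
      have := hinj _ (by omega) _ (by omega) e2
      omega
  have := hcy.girth_le_length
  simpa [hl] using this

/-- cyclic form after sign switching -/
noncomputable def cycF (n : ℕ) (s : ℝ) (x : ℕ → ℝ) : ℝ :=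
  ∑ i ∈ Finset.range (n-1), x i * x (i+1) + s * x (n-1) * x 0

theorem cycF_step (n : ℕ) (hn : 1 ≤ n) (s : ℝ) (hs : s * s = 1) (x : ℕ → ℝ) :
    cycF (n+2) s x = cycF n (-s) x + (x n + s * x 0) * (x (n+1) + x (n-1)) := by
  obtain ⟨k, rfl⟩ : ∃ k, n = k+1 := ⟨n-1, by omega⟩
  simp only [cycF, Nat.add_sub_cancel, show k+1+2-1 = k+1+1 by omega, Finset.sum_range_succ]
  linear_combination (0:ℝ) * hs

theorem cycF_neg (o : ℕ) (x : ℕ → ℝ) (ho : o = 0 ∨ o = 1) : ∀ m : ℕ, 1 ≤ m →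
    (∀ j < m, x (2*j+o) + (-1)^j * x 0 + x (2*j+o+1) + x (2*j+o-1) = 0) →
    cycF (2*m+o) ((-1)^(m+1)) x ≤ 0 ∧
      (cycF (2*m+o) ((-1)^(m+1)) x = 0 → ∀ i < 2*m+o, x i = 0) := by
  intro m hm
  induction m, hm using Nat.le_induction with
  | base =>
    intro h
    have h0 := h 0 (by omega)
    rcases ho with rfl | rfl
    · simp [cycF] at h0 ⊢
      have : x 1 = - 3 * x 0 := by linarith
      rw [this]
      refine ⟨by nlinarith [sq_nonneg (x 0)], fun h i hi => ?_⟩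
      have : x 0 = 0 := by
        have : x 0 ^2 = 0 := by linarith
        simpa using this
      interval_cases i <;> simp_all
    · simp [cycF, Finset.sum_range_succ] at h0 ⊢
      have : x 2 = - x 1 - 2 * x 0 := by linarith
      have e : x 0 * x 1 + x 1 * x 2 + x 2 * x 0 = -(x 0 + x 1)^2 - x 0 ^2 := by
        rw [this]; ring
      rw [e]
      refine ⟨by nlinarith [sq_nonneg (x 0), sq_nonneg (x 0 + x 1)], fun h i hi => ?_⟩
      have h0 : x 0 = 0 := by
        have : x 0 ^2 = 0 := by nlinarith [sq_nonneg (x 0), sq_nonneg (x 0 + x 1)]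
        simpa using this
      have h1 : x 1 = 0 := by
        rw [h0] at h
        have : x 1 ^2 = 0 := by linarith
        simpa using this
      interval_cases i <;> simp_all
  | succ m hm ih =>
    intro h
    obtain ⟨i1, i2⟩ := ih (fun j hj => h j (by omega))
    have hc := h m (by omega)
    have hst := cycF_step (2*m+o) (by omega) ((-1)^(m+1+1)) (by rw [← mul_pow]; simp) x
    rw [show 2*(m+1)+o = 2*m+o+2 by ring, hst]
    have e1 : -(-1:ℝ)^(m+1+1) = (-1)^(m+1) := by ring
    have e2 : (-1:ℝ)^(m+1+1) = (-1)^m := by ring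
    rw [e1, e2]
    have e3 : x (2*m+o+1) + x (2*m+o-1) = -(x (2*m+o) + (-1)^m * x 0) := by linarith
    rw [e3]
    set b := x (2*m+o) + (-1)^m * x 0 with hb
    refine ⟨by nlinarith [sq_nonneg b], fun hz i hi => ?_⟩
    have hF := i2 (by nlinarith [sq_nonneg b])
    have hb0 : b = 0 := by
      have : b^2 = 0 := by nlinarith [sq_nonneg b]
      simpa using this
    have z0 := hF 0 (by omega)
    have z1 := hF (2*m+o-1) (by omega)
    rcases lt_or_ge i (2*m+o) with h1 | h1
    · exact hF i h1
    · have : i = 2*m+o ∨ i = 2*m+o+1 := by omega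
      rw [hb0] at hb e3
      rcases this with rfl | rfl
      · rw [z0] at hb; linarith
      · linarith

theorem cyc_sum (n : ℕ) (hn : 2 ≤ n) (M : ℕ → ℕ → ℝ) (hsym : ∀ i j, M i j = M j i)
    (hdiag : ∀ i, M i i = 0)
    (hM : ∀ i j, i < j → j ≤ n → j ≠ i+1 → ¬ (i = 0 ∧ j = n) → M i j = 0) :
    ∑ i ∈ Finset.range (n+1), ∑ j ∈ Finset.range (n+1), M i j =
      2 * (∑ i ∈ Finset.range n, M i (i+1) + M n 0) := by
  have key : ∀ i ∈ Finset.range (n+1), ∀ j ∈ Finset.range (n+1), M i j =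
      (if j = i+1 then M i (i+1) else 0) + (if i = j+1 then M j (j+1) else 0)
      + (if i = n then (if j = 0 then M n 0 else 0) else 0)
      + (if j = n then (if i = 0 then M n 0 else 0) else 0) := by
    intro i hi j hj
    simp only [Finset.mem_range] at hi hj
    rcases lt_trichotomy i j with h | h | h
    · by_cases h1 : j = i+1
      · subst h1
        have a1 : ¬ (i = i+1+1) := by omega
        have a2 : ¬ (i = n) := by omega
        have a3 : ¬ (i + 1 = n ∧ i = 0) := by omega
        simp only [a1, a2, if_true, if_false, ← ite_and, a3]; simp
      · have a1 : ¬ (i = j+1) := by omega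
        have a2 : ¬ (i = n) := by omega
        by_cases h2 : i = 0 ∧ j = n
        · obtain ⟨rfl, rfl⟩ := h2
          simp only [h1, a1, a2, if_true, if_false]; simp [hsym]
        · rw [hM i j h (by omega) h1 h2]
          have a3 : ¬ (j = n ∧ i = 0) := by omega
          simp only [h1, a1, a2, if_false, ← ite_and, a3]; simp
    · subst h
      have a1 : ¬ (i = n ∧ i = 0) := by omega
      simp [hdiag, ← ite_and, a1]
    · rw [hsym i j]
      by_cases h1 : i = j+1
      · subst h1
        have a1 : ¬ (j = j+1+1) := by omega
        have a2 : ¬ (j = n) := by omega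
        have a3 : ¬ (j + 1 = n ∧ j = 0) := by omega
        simp only [a1, a2, if_true, if_false, ← ite_and, a3]; simp
      · have a1 : ¬ (j = i+1) := by omega
        have a2 : ¬ (j = n) := by omega
        by_cases h2 : j = 0 ∧ i = n
        · obtain ⟨rfl, rfl⟩ := h2
          simp only [h1, a1, a2, if_true, if_false]; simp [hsym]
        · rw [hM j i h (by omega) h1 h2]
          have a3 : ¬ (i = n ∧ j = 0) := by omega
          simp only [h1, a1, a2, if_false, ← ite_and, a3]; simp
  rw [Finset.sum_congr rfl fun i hi => Finset.sum_congr rfl (key i hi)]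
  simp only [Finset.sum_add_distrib]
  have s1 : ∑ i ∈ Finset.range (n+1), ∑ j ∈ Finset.range (n+1),
      (if j = i+1 then M i (i+1) else 0) = ∑ i ∈ Finset.range n, M i (i+1) := by
    rw [Finset.sum_range_succ]
    simp only [Finset.sum_ite_eq', Finset.mem_range]
    rw [if_neg (by omega), add_zero]
    exact Finset.sum_congr rfl fun i hi => if_pos (by simpa using hi)
  have s2 : ∑ i ∈ Finset.range (n+1), ∑ j ∈ Finset.range (n+1),
      (if i = j+1 then M j (j+1) else 0) = ∑ i ∈ Finset.range n, M i (i+1) := by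
    rw [Finset.sum_comm]; exact s1
  have s3 : ∑ i ∈ Finset.range (n+1), ∑ j ∈ Finset.range (n+1),
      (if i = n then (if j = 0 then M n 0 else 0) else 0) = M n 0 := by
    rw [Finset.sum_comm]; simp
  have s4 : ∑ i ∈ Finset.range (n+1), ∑ j ∈ Finset.range (n+1),
      (if j = n then (if i = 0 then M n 0 else 0) else 0) = M n 0 := by
    simp
  rw [s1, s2, s3, s4]; ring

theorem quad_nonneg {n : Type} [Fintype n] [DecidableEq n]
    {A : Matrix n n ℝ} (hA : A.IsHermitian) (x : n → ℝ)
    (hx : ∀ i, hA.eigenvalues i < 0 → ∑ j, (hA.eigenvectorUnitary : Matrix n n ℝ) j i * x j = 0) :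
    0 ≤ x ⬝ᵥ (A.mulVec x) := by
  classical
  set U : Matrix n n ℝ := (hA.eigenvectorUnitary : Matrix n n ℝ) with hU
  have hsp : A = U * Matrix.diagonal hA.eigenvalues * U.transpose := by
    have := hA.spectral_theorem
    rw [Unitary.conjStarAlgAut_apply] at this
    simpa [Matrix.star_eq_conjTranspose, Function.comp_def] using this
  have : x ⬝ᵥ (A.mulVec x) = ∑ i, hA.eigenvalues i * (∑ j, U j i * x j)^2 := by
    conv_lhs => rw [hsp]
    rw [← Matrix.mulVec_mulVec, ← Matrix.mulVec_mulVec, Matrix.dotProduct_mulVec,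
      ← Matrix.mulVec_transpose]
    simp only [dotProduct, Matrix.mulVec_diagonal]
    refine Finset.sum_congr rfl fun i _ => ?_
    simp only [Matrix.mulVec, dotProduct, Matrix.transpose_apply]
    ring
  rw [this]
  refine Finset.sum_nonneg fun i _ => ?_
  rcases lt_or_ge (hA.eigenvalues i) 0 with h | h
  · rw [hx i h]; simp
  · positivity

theorem exists_common_zero {ι : Type} [Fintype ι] (N : ℕ) (φ : ι → ((Fin N → ℝ) →ₗ[ℝ] ℝ))
    (h : Fintype.card ι < N) : ∃ v : Fin N → ℝ, v ≠ 0 ∧ ∀ i, φ i v = 0 := by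
  have := LinearMap.ker_ne_bot_of_finrank_lt (f := LinearMap.pi φ) (by simpa using h)
  obtain ⟨v, hv, h0⟩ := (Submodule.ne_bot_iff _).1 this
  exact ⟨v, h0, fun i => congrFun (LinearMap.mem_ker.1 hv) i⟩

theorem quad_expand {V : Type} [Fintype V] [DecidableEq V] (A : Matrix V V ℝ) (N : ℕ)
    (e : ℕ → V) (z : ℕ → ℝ) (X : V → ℝ)
    (hX : X = ∑ i ∈ Finset.range N, z i • Pi.single (e i) (1:ℝ)) :
    X ⬝ᵥ (A.mulVec X) = ∑ i ∈ Finset.range N, ∑ j ∈ Finset.range N, z i * z j * A (e i) (e j) := by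
  rw [hX, Matrix.mulVec_sum, sum_dotProduct]
  refine Finset.sum_congr rfl fun i _ => ?_
  rw [dotProduct_sum]
  refine Finset.sum_congr rfl fun j _ => ?_
  rw [Matrix.mulVec_smul, smul_dotProduct, dotProduct_smul]
  simp [mul_assoc]

theorem sum4 (g : ℕ) (T : ℕ → ℕ → ℝ) (hT : ∀ i j, T i j = T j i) (hd : ∀ i, T i i = 0) :
    ∑ i ∈ Finset.range (g+4), ∑ j ∈ Finset.range (g+4), T i j =
    ∑ i ∈ Finset.range g, ∑ j ∈ Finset.range g, T i j
     + 2 * (∑ i ∈ Finset.range g, T g i + ∑ i ∈ Finset.range g, T (g+1) i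
      + ∑ i ∈ Finset.range g, T (g+2) i + ∑ i ∈ Finset.range g, T (g+3) i
      + T g (g+1) + T g (g+2) + T g (g+3) + T (g+1) (g+2) + T (g+1) (g+3) + T (g+2) (g+3)) := by
  have h : ∀ k, ∑ i ∈ Finset.range g, T i k = ∑ i ∈ Finset.range g, T k i :=
    fun k => Finset.sum_congr rfl fun i _ => hT i k
  simp only [Finset.sum_range_succ, Finset.sum_add_distrib, h, hd]
  rw [hT (g+1) g, hT (g+2) g, hT (g+3) g, hT (g+2) (g+1), hT (g+3) (g+1), hT (g+3) (g+2)]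
  ring

theorem key_ineq {V : Type} [Fintype V] [DecidableEq V]
    (G : SimpleGraph V) (A : Matrix V V ℝ) (hA : A.IsHermitian)
    (hone : ∀ u v, G.Adj u v → A u v = 1 ∨ A u v = -1)
    (hzero : ∀ u v, ¬ G.Adj u v → A u v = 0)
    (g m o : ℕ) (ho : o = 0 ∨ o = 1) (hm : 1 ≤ m) (hg3 : 3 ≤ g) (hg : g = 2 * m + o)
    (hmodd : Odd m)
    (h : ℕ → V)
    (hadj : ∀ i, i + 1 < g → G.Adj (h i) (h (i+1)))
    (hchord : ∀ i j, i < j → j < g → j ≠ i + 1 → ¬ (i = 0 ∧ j = g - 1) → ¬ G.Adj (h i) (h j))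
    (hbal : (∏ i ∈ Finset.range (g-1), A (h i) (h (i+1))) * A (h (g-1)) (h 0) = 1)
    (p q r t : V) (hpq : G.Adj p q) (hrt : G.Adj r t) (hpt : ¬ G.Adj p t) (hqt : ¬ G.Adj q t)
    (hq : ∀ i < g, ¬ G.Adj q (h i)) (ht : ∀ i < g, ¬ G.Adj t (h i)) :
    m + o + 2 ≤ negInertia hA := by
  by_contra hlt
  push Not at hlt
  have hsym : ∀ u v, A u v = A v u := fun u v => by
    have := hA.apply u v; simpa using this.symm
  let d : ℕ → ℝ := fun i => ∏ j ∈ Finset.range i, A (h j) (h (j+1))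
  have hsq : ∀ u v, G.Adj u v → A u v * A u v = 1 := fun u v huv => by
    rcases hone u v huv with h | h <;> rw [h] <;> norm_num
  have hd : ∀ i < g, d i * d i = 1 := by
    intro i hi
    simp only [d]
    rw [← Finset.prod_mul_distrib]
    exact Finset.prod_eq_one fun j hj => hsq _ _ (hadj j (by simp at hj; omega))
  let e : ℕ → V := fun i => if i < g then h i else if i = g then p else
    if i = g+1 then q else if i = g+2 then r else t
  have e0 : ∀ i < g, e i = h i := fun i hi => by simp [e, hi]
  have e1 : e g = p := by simp [e]
  have e2 : e (g+1) = q := by simp [e]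
  have e3 : e (g+2) = r := by simp [e]
  have e4 : e (g+3) = t := by simp [e]
  let D : ℕ → ℝ := fun i => if i < g then d i else 1
  have D0 : ∀ i < g, D i = d i := fun i hi => by simp [D, hi]
  have D1 : D g = 1 := by simp [D]
  have D2 : D (g+1) = 1 := by simp [D]
  have D3 : D (g+2) = 1 := by simp [D]
  have D4 : D (g+3) = 1 := by simp [D]
  let c : ℕ → ((Fin (g+4) → ℝ) →ₗ[ℝ] ℝ) := fun i =>
    if hi : i < g + 4 then LinearMap.proj ⟨i, hi⟩ else 0
  let S : V → ((Fin (g+4) → ℝ) →ₗ[ℝ] ℝ) := fun a =>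
    ∑ i ∈ Finset.range g, (D i * A a (h i)) • c i
  let ι := Fin m ⊕ (Fin 2 ⊕ {i // hA.eigenvalues i < 0})
  let φ : ι → ((Fin (g+4) → ℝ) →ₗ[ℝ] ℝ) := fun k => match k with
    | Sum.inl j => c (2*j+o) + ((-1:ℝ)^(j:ℕ)) • c 0 + c (2*j+o+1) + c (2*j+o-1)
    | Sum.inr (Sum.inl 0) => S p + A p r • c (g+2) + A p q • c (g+1) + c g
    | Sum.inr (Sum.inl 1) => S r + A r t • c (g+3) + A q r • c (g+1) + c (g+2)
    | Sum.inr (Sum.inr i) => ∑ v, (hA.eigenvectorUnitary : Matrix V V ℝ) v i •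
        ∑ k ∈ Finset.range (g+4), (D k * (Pi.single (e k) (1:ℝ) : V → ℝ) v) • c k
  have hcard : Fintype.card ι < g + 4 := by
    simp only [ι, Fintype.card_sum, Fintype.card_fin, Fintype.card_subtype]
    unfold negInertia at hlt
    omega
  obtain ⟨v, hv0, hv⟩ := exists_common_zero (g+4) φ hcard
  let y : ℕ → ℝ := fun i => c i v
  let z : ℕ → ℝ := fun i => D i * y i
  obtain ⟨X, hX⟩ : ∃ X, X = ∑ i ∈ Finset.range (g+4), z i • (Pi.single (e i) (1:ℝ) : V → ℝ) :=
    ⟨_, rfl⟩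
  have hpos : 0 ≤ X ⬝ᵥ (A.mulVec X) := by
    apply quad_nonneg hA
    intro i hi
    have := hv (Sum.inr (Sum.inr ⟨i, hi⟩))
    simp only [φ, LinearMap.sum_apply, LinearMap.smul_apply, smul_eq_mul] at this
    rw [← this]
    refine Finset.sum_congr rfl fun j _ => ?_
    rw [hX, Finset.sum_apply]
    congr 1
    refine Finset.sum_congr rfl fun k _ => ?_
    simp only [Pi.smul_apply, smul_eq_mul, z, y]; ring
  have hc0 : ∀ j < m, y (2*j+o) + (-1)^j * y 0 + y (2*j+o+1) + y (2*j+o-1) = 0 := by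
    intro j hj
    have := hv (Sum.inl ⟨j, hj⟩)
    simpa [φ, y] using this
  have hSe : ∀ a, S a v = ∑ i ∈ Finset.range g, z i * A a (h i) := by
    intro a
    simp only [S, LinearMap.sum_apply, LinearMap.smul_apply, smul_eq_mul, z, y]
    exact Finset.sum_congr rfl fun i _ => by ring
  have hc1 : S p v + A p r * y (g+2) + A p q * y (g+1) + y g = 0 := by
    have := hv (Sum.inr (Sum.inl 0))
    simpa [φ, y] using this
  have hc2 : S r v + A r t * y (g+3) + A q r * y (g+1) + y (g+2) = 0 := by
    have := hv (Sum.inr (Sum.inl 1))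
    simpa [φ, y] using this
  obtain ⟨n1, n2⟩ := cycF_neg o y ho m hm hc0
  have hs1 : (-1:ℝ)^(m+1) = 1 := (Odd.add_one hmodd).neg_one_pow
  rw [hs1, ← hg] at n1 n2
  have hcyc : ∑ i ∈ Finset.range g, ∑ j ∈ Finset.range g, z i * z j * A (e i) (e j)
      = 2 * cycF g 1 y := by
    obtain ⟨n, rfl⟩ : ∃ n, g = n + 1 := ⟨g-1, by omega⟩
    rw [cyc_sum n (by omega) (fun i j => z i * z j * A (e i) (e j))]
    · simp only [cycF, Nat.add_sub_cancel]
      congr 2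
      · refine Finset.sum_congr rfl fun i hi => ?_
        have hi' : i < n := by simpa using hi
        simp only [z]
        rw [e0 i (by omega), e0 (i+1) (by omega), D0 i (by omega), D0 (i+1) (by omega)]
        have a1 : d (i+1) = d i * A (h i) (h (i+1)) := Finset.prod_range_succ _ _
        have a2 := hd (i+1) (by omega)
        linear_combination (y i * y (i+1)) * a2 - d (i+1) * y i * y (i+1) * a1
      · simp only [z]
        rw [e0 n (by omega), e0 0 (by omega), D0 n (by omega), D0 0 (by omega)]
        have a1 : d 0 = 1 := by simp [d]
        have a2 : d n * A (h n) (h 0) = 1 := by simpa using hbal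
        rw [a1]
        linear_combination (y n * y 0) * a2
    · intro i j
      rw [hsym]; ring
    · intro i
      simp [hzero _ _ (G.loopless.irrefl _)]
    · intro i j hij hj h1 h2
      rw [e0 i (by omega), e0 j (by omega), hzero _ _ (hchord i j hij (by omega) h1 (by simpa using h2)),
        mul_zero]
  have hQ := quad_expand A (g+4) e z X hX
  rw [sum4 g (fun i j => z i * z j * A (e i) (e j))
    (fun i j => by rw [hsym]; ring)
    (fun i => by simp [hzero _ _ (G.loopless.irrefl _)]), hcyc] at hQ
  have hSS : ∀ k, ∑ i ∈ Finset.range g, z k * z i * A (e k) (e i) = z k * S (e k) v := by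
    intro k
    rw [hSe, Finset.mul_sum]
    refine Finset.sum_congr rfl fun i hi => ?_
    rw [e0 i (by simpa using hi)]; ring
  have hS0 : ∀ a, (∀ i < g, ¬ G.Adj a (h i)) → S a v = 0 := by
    intro a ha
    rw [hSe]
    exact Finset.sum_eq_zero fun i hi => by
      rw [hzero _ _ (ha i (by simpa using hi)), mul_zero]
  beta_reduce at hQ
  rw [hSS g, hSS (g+1), hSS (g+2), hSS (g+3)] at hQ
  simp only [e1, e2, e3, e4] at hQ
  rw [hS0 q hq, hS0 t ht, hzero _ _ hpt, hzero _ _ hqt] at hQ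
  simp only [z, D1, D2, D3, D4, one_mul] at hQ
  have hQ' : X ⬝ᵥ A.mulVec X = 2 * (cycF g 1 y - y g ^ 2 - y (g+2)^2) := by
    rw [hQ]
    linear_combination 2 * y g * hc1 + 2 * y (g+2) * hc2
  rw [hQ'] at hpos
  have z1 : y g = 0 := by
    have : y g ^ 2 = 0 := by nlinarith [sq_nonneg (y g), sq_nonneg (y (g+2))]
    simpa using this
  have z3 : y (g+2) = 0 := by
    have : y (g+2) ^ 2 = 0 := by nlinarith [sq_nonneg (y g), sq_nonneg (y (g+2))]
    simpa using this
  have zc := n2 (by nlinarith [sq_nonneg (y g), sq_nonneg (y (g+2))])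
  have hSz : ∀ a, S a v = 0 := by
    intro a
    rw [hSe]
    exact Finset.sum_eq_zero fun i hi => by simp [z, zc i (by simpa using hi)]
  have hne : ∀ u v, G.Adj u v → A u v ≠ 0 := fun u v huv h0 => by
    have := hsq u v huv; rw [h0] at this; norm_num at this
  rw [hSz, z1, z3] at hc1
  have z2 : y (g+1) = 0 := by
    have : A p q * y (g+1) = 0 := by linarith
    exact (mul_eq_zero.1 this).resolve_left (hne _ _ hpq)
  rw [hSz, z2, z3] at hc2
  have z4 : y (g+3) = 0 := by
    have : A r t * y (g+3) = 0 := by linarith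
    exact (mul_eq_zero.1 this).resolve_left (hne _ _ hrt)
  apply hv0
  funext i
  have hyi : v i = y i := by simp [y, c, i.2]
  rw [hyi, Pi.zero_apply]
  have : (i:ℕ) < g ∨ (i:ℕ) = g ∨ (i:ℕ) = g+1 ∨ (i:ℕ) = g+2 ∨ (i:ℕ) = g+3 := by
    have := i.2; omega
  rcases this with h | h | h | h | h
  · exact zc _ h
  all_goals rw [h]; assumption

theorem girth_le_four {V : Type} (G : SimpleGraph V) (a b c d : V) (hab : G.Adj a b)
    (hbc : G.Adj b c) (hcd : G.Adj c d) (hda : G.Adj d a) (hac : a ≠ c) (hbd : b ≠ d) :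
    G.girth ≤ 4 := by
  have hcy : (Walk.cons hab (Walk.cons hbc (Walk.cons hcd (Walk.cons hda Walk.nil)))).IsCycle := by
    rw [Walk.cons_isCycle_iff]
    have := hab.ne
    have := hbc.ne
    have := hcd.ne
    have := hda.ne
    simp [Walk.cons_isPath_iff]
    grind
  simpa using hcy.girth_le_length

theorem dtc_le {V : Type} (G : SimpleGraph V) {g : ℕ} (f : ZMod g → V) (v : V) (m : ZMod g) :
    distToCycle G f v ≤ G.dist v (f m) := Nat.sInf_le ⟨m, rfl⟩

theorem dtc_ex {V : Type} (G : SimpleGraph V) {g : ℕ} (f : ZMod g → V) (v : V) :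
    ∃ m, G.dist v (f m) = distToCycle G f v :=
  Nat.sInf_mem (s := {d : ℕ | ∃ m : ZMod g, G.dist v (f m) = d}) ⟨_, 0, rfl⟩

theorem dtc_adj {V : Type} (G : SimpleGraph V) (hconn : G.Connected) {g : ℕ} (f : ZMod g → V)
    (u v : V) (h : G.Adj u v) : distToCycle G f u ≤ distToCycle G f v + 1 := by
  obtain ⟨m, hm⟩ := dtc_ex G f v
  have h1 := dtc_le G f u m
  have h2 := hconn.dist_triangle (u := u) (v := v) (w := f m)
  have h3 : G.dist u v = 1 := SimpleGraph.dist_eq_one_iff_adj.2 h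
  omega

theorem dtc_self {V : Type} (G : SimpleGraph V) {g : ℕ} (f : ZMod g → V) (m : ZMod g) :
    distToCycle G f (f m) = 0 := by
  have := dtc_le G f (f m) m
  simpa using this

theorem dtc_parent {V : Type} (G : SimpleGraph V) (hconn : G.Connected) {g : ℕ} (f : ZMod g → V)
    (v : V) (n : ℕ) (h : distToCycle G f v = n + 1) :
    ∃ u, G.Adj v u ∧ distToCycle G f u = n := by
  obtain ⟨m, hm⟩ := dtc_ex G f v
  obtain ⟨p, hp⟩ := hconn.exists_walk_length_eq_dist v (f m)
  rw [hm, h] at hp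
  generalize hw : f m = w at p
  cases p with
  | nil => simp at hp
  | @cons _ u _ ha p' =>
    refine ⟨u, ha, ?_⟩
    subst hw
    have h1 := dtc_le G f u m
    have h2 := SimpleGraph.dist_le p'
    have h3 := dtc_adj G hconn f v u ha
    simp at hp
    omega

/-- For a connected triangle-free signed graph `Γ` (adjacency matrix `A`
over the underlying graph `G`) with girth `g ≡ 2, 3 (mod 4)`, containing a balanced
shortest cycle parametrized by `f : ZMod g → V`, with `i₋(Γ) = ⌈g/2⌉ + 1`: if some
vertex is at distance exactly `3` from the cycle, then exactly one vertex is at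
distance exactly `2` from the cycle. -/
theorem stmt_5 {V : Type} [Fintype V] [DecidableEq V]
    (G : SimpleGraph V) (hconn : G.Connected) (htf : G.CliqueFree 3)
    (A : Matrix V V ℝ) (hA : A.IsHermitian)
    (hone : ∀ u v, G.Adj u v → A u v = 1 ∨ A u v = -1)
    (hzero : ∀ u v, ¬ G.Adj u v → A u v = 0)
    (g : ℕ) (hgirth : G.girth = (g : ℕ∞)) (hmod : g % 4 = 2 ∨ g % 4 = 3)
    (f : ZMod g → V) (hfinj : Function.Injective f)
    (hcyc : ∀ m : ZMod g, G.Adj (f m) (f (m + 1)))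
    (hbal : ∏ i : Fin g, A (f (((i : ℕ) : ZMod g))) (f (((i : ℕ) : ZMod g) + 1)) = 1)
    (hneg : negInertia hA = (g + 1) / 2 + 1)
    (h3 : ∃ v : V, distToCycle G f v = 3) :
    ∃! v : V, distToCycle G f v = 2 := by
  have hg : G.girth = g := by exact_mod_cast hgirth
  have htri : ∀ a b c, G.Adj a b → G.Adj b c → ¬ G.Adj a c := by
    intro a b c hab hbc hac
    exact htf {a, b, c} (SimpleGraph.is3Clique_triple_iff.2 ⟨hab, hac, hbc⟩)
  have hg3 : 3 ≤ g := by
    rw [← hg]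
    apply SimpleGraph.three_le_girth
    rw [← SimpleGraph.girth_eq_zero]
    omega
  have hgn3 : g ≠ 3 := by
    rintro rfl
    have a := hcyc 0
    have b := hcyc 1
    have c := hcyc 2
    rw [show (0:ZMod 3) + 1 = 1 by decide] at a
    rw [show (1:ZMod 3) + 1 = 2 by decide] at b
    rw [show (2:ZMod 3) + 1 = 0 by decide] at c
    exact htri _ _ _ a b c.symm
  have hg6 : 6 ≤ g := by omega
  let h : ℕ → V := fun i => f (i : ZMod g)
  have hadj : ∀ i, G.Adj (h i) (h (i+1)) := fun i => by
    have := hcyc (i : ZMod g)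
    simpa [h] using this
  have hinj : ∀ i < g, ∀ j < g, h i = h j → i = j := by
    intro i hi j hj hij
    have := hfinj hij
    rw [ZMod.natCast_eq_natCast_iff'] at this
    rwa [Nat.mod_eq_of_lt hi, Nat.mod_eq_of_lt hj] at this
  have hchord : ∀ i j, i < j → j < g → j ≠ i + 1 → ¬ (i = 0 ∧ j = g - 1) →
      ¬ G.Adj (h i) (h j) := by
    intro i j hij hj h1 h2 ha
    have := girth_le_seq G (fun k => h (i + k)) (j - i) (by omega)
      (fun k _ => hadj (i+k))
      (fun a ha b hb hab => by
        have := hinj _ (by omega) _ (by omega) hab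
        omega)
      (by
        simp only [show i + (j - i) = j by omega, add_zero]
        exact ha.symm)
    omega
  have hbal' : (∏ i ∈ Finset.range (g-1), A (h i) (h (i+1))) * A (h (g-1)) (h 0) = 1 := by
    rw [← hbal, Fin.prod_univ_eq_prod_range
      (fun i => A (f ((i : ZMod g))) (f ((i : ZMod g) + 1))) g]
    obtain ⟨n, rfl⟩ : ∃ n, g = n + 1 := ⟨g-1, by omega⟩
    rw [Finset.prod_range_succ]
    simp only [Nat.add_sub_cancel, h]
    congr 1
    · exact Finset.prod_congr rfl fun i _ => by push_cast; rfl
    · have : ((n : ZMod (n+1)) + 1) = ((0:ℕ) : ZMod (n+1)) := by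
        have := ZMod.natCast_self (n+1)
        push_cast at this ⊢
        exact this
      rw [this]
  have main : ∀ p q r t : V, G.Adj p q → G.Adj r t → ¬ G.Adj p t → ¬ G.Adj q t →
      2 ≤ distToCycle G f q → 2 ≤ distToCycle G f t → False := by
    intro p q r t hpq hrt hpt hqt hq ht
    have hfar : ∀ a, 2 ≤ distToCycle G f a → ∀ i < g, ¬ G.Adj a (h i) := by
      intro a ha i _ hai
      have h1 := dtc_adj G hconn f _ _ hai
      have h2 := dtc_self G f (i : ZMod g)
      simp only [h] at h1
      omega
    have := key_ineq G A hA hone hzero g (g/2) (g%2) (by omega) (by omega) hg3 (by omega)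
      (by rw [Nat.odd_iff]; omega) h (fun i _ => hadj i) hchord hbal' p q r t hpq hrt hpt hqt
      (hfar q hq) (hfar t ht)
    omega
  obtain ⟨v3, d3⟩ := h3
  obtain ⟨v2, a32, d2⟩ := dtc_parent G hconn f v3 2 d3
  obtain ⟨v1, a21, d1⟩ := dtc_parent G hconn f v2 1 d2
  refine ⟨v2, d2, fun w dw => ?_⟩
  by_contra hne
  obtain ⟨x, awx, dx⟩ := dtc_parent G hconn f w 1 dw
  by_cases hw3 : G.Adj w v3
  · refine main v1 v2 x w a21.symm awx.symm ?_ ?_ (by omega) (by omega)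
    · intro h1w
      have := girth_le_four G v1 v2 v3 w a21.symm a32.symm hw3.symm h1w.symm
        (by rintro rfl; omega) (fun h => hne h.symm)
      omega
    · exact fun h2w => htri _ _ _ a32 h2w hw3.symm
  · refine main x w v2 v3 awx.symm a32.symm ?_ hw3 (by omega) (by omega)
    intro hx3
    have := dtc_adj G hconn f _ _ hx3.symm
    omega
end

section
/- Let G be a finite simple graph with girth g ≥ 6 and let C be a shortest cycle of G. If x is a vertex of G at distance exactly 2 from V(C), then at most three neighbors of x have a neighbor on C. -/
theorem arc_path {V : Type} (G : SimpleGraph V) (g : ℕ) (hg : 6 ≤ g)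
    (f : ZMod g → V) (hfinj : Function.Injective f)
    (hcyc : ∀ m : ZMod g, G.Adj (f m) (f (m + 1))) (m : ZMod g) (d : ℕ) (hd : d < g) :
    ∃ p : G.Walk (f m) (f (m + (d : ZMod g))), p.IsPath ∧ p.length = d ∧
      ∀ u ∈ p.support, ∃ j : ℕ, j ≤ d ∧ u = f (m + (j : ZMod g)) := by
  induction d with
  | zero =>
    refine ⟨SimpleGraph.Walk.nil.copy rfl (by simp), by simp, by simp, ?_⟩
    intro u hu
    refine ⟨0, le_rfl, ?_⟩
    simpa using hu
  | succ d ih =>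
    obtain ⟨p, hp, hl, hs⟩ := ih (by omega)
    have hadj : G.Adj (f (m + (d : ZMod g))) (f (m + ((d + 1 : ℕ) : ZMod g))) := by
      have := hcyc (m + (d : ZMod g))
      rwa [add_assoc, ← Nat.cast_succ] at this
    refine ⟨p.concat hadj, ?_, by simp [hl], ?_⟩
    · refine hp.concat ?_ hadj
      intro hmem
      obtain ⟨j, hj, he⟩ := hs _ hmem
      have h1 := add_left_cancel (hfinj he)
      rw [ZMod.natCast_eq_natCast_iff'] at h1
      rw [Nat.mod_eq_of_lt hd, Nat.mod_eq_of_lt (by omega)] at h1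
      omega
    · intro u hu
      rw [SimpleGraph.Walk.support_concat] at hu
      simp only [List.concat_eq_append, List.mem_append, List.mem_singleton] at hu
      rcases hu with hu | hu
      · obtain ⟨j, hj, he⟩ := hs _ hu
        exact ⟨j, by omega, he⟩
      · exact ⟨d + 1, le_rfl, hu⟩

theorem arc_bound {V : Type} (G : SimpleGraph V)
    (g : ℕ) (hg : 6 ≤ g) (hgirth : G.girth = g)
    (f : ZMod g → V) (hfinj : Function.Injective f)
    (hcyc : ∀ m : ZMod g, G.Adj (f m) (f (m + 1)))
    (x : V) (hx1 : ∀ m, x ≠ f m) (hx2 : ∀ m, ¬ G.Adj x (f m))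
    (v w : V) (hvw : v ≠ w) (hv : G.Adj x v) (hw : G.Adj x w) (m : ZMod g) (d : ℕ)
    (hd : d < g)
    (hvm : G.Adj v (f m)) (hwn : G.Adj w (f (m + (d : ZMod g)))) : g ≤ d + 4 := by
  obtain ⟨p, hp, hl, hs⟩ := arc_path G g hg f hfinj hcyc m d hd
  have hvp : v ∉ p.support := by
    intro h
    obtain ⟨j, -, he⟩ := hs _ h
    exact hx2 _ (he ▸ hv)
  have hwp : w ∉ p.support := by
    intro h
    obtain ⟨j, -, he⟩ := hs _ h
    exact hx2 _ (he ▸ hw)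
  have hxp : x ∉ p.support := by
    intro h
    obtain ⟨j, -, he⟩ := hs _ h
    exact hx1 _ he
  have hq : (p.concat hwn.symm).IsPath := hp.concat hwp _
  have hr : (SimpleGraph.Walk.cons hvm (p.concat hwn.symm)).IsPath := by
    rw [SimpleGraph.Walk.cons_isPath_iff]
    refine ⟨hq, ?_⟩
    simp [SimpleGraph.Walk.support_concat, hvp, hvw]
  have hxr : x ∉ (SimpleGraph.Walk.cons hvm (p.concat hwn.symm)).support := by
    simp [SimpleGraph.Walk.support_concat, hxp, hv.ne, hw.ne]
  have hc : (SimpleGraph.Walk.cons hv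
      ((SimpleGraph.Walk.cons hvm (p.concat hwn.symm)).concat hw.symm)).IsCycle := by
    rw [SimpleGraph.Walk.cons_isCycle_iff]
    refine ⟨hr.concat hxr _, ?_⟩
    rw [SimpleGraph.Walk.edges_concat]
    intro h
    simp only [List.concat_eq_append, List.mem_append, List.mem_singleton] at h
    rcases h with h | h
    · exact hxr (SimpleGraph.Walk.fst_mem_support_of_mem_edges _ h)
    · rw [Sym2.eq_swap, Sym2.congr_left] at h
      exact hvw h
  have := hc.girth_le_length
  simp [hl] at this
  omega

/-- In a finite simple graph with girth `g ≥ 6`, with a shortest cycle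
parametrized by `f : ZMod g → V`, a vertex `x` at distance exactly `2` from the cycle
has at most three neighbours having a neighbour on the cycle. -/
theorem stmt_6 {V : Type} [Fintype V] (G : SimpleGraph V)
    (g : ℕ) (hg : 6 ≤ g) (hgirth : G.girth = (g : ℕ∞))
    (f : ZMod g → V) (hfinj : Function.Injective f)
    (hcyc : ∀ m : ZMod g, G.Adj (f m) (f (m + 1)))
    (x : V) (hx : distToCycle G f x = 2) :
    {v : V | G.Adj x v ∧ ∃ m : ZMod g, G.Adj v (f m)}.ncard ≤ 3 := by
  have hg' : G.girth = g := by exact_mod_cast hgirth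
  have hdist : ∀ m, 2 ≤ G.dist x (f m) := by
    intro m
    rw [← hx]
    exact Nat.sInf_le ⟨m, rfl⟩
  have hx1 : ∀ m, x ≠ f m := by
    intro m h
    have := hdist m
    rw [← h] at this
    simp at this
  have hx2 : ∀ m, ¬ G.Adj x (f m) := by
    intro m h
    have := hdist m
    rw [SimpleGraph.dist_eq_one_iff_adj.mpr h] at this
    omega
  haveI : NeZero g := ⟨by omega⟩
  by_contra hcard
  push Not at hcard
  set S := {v : V | G.Adj x v ∧ ∃ m : ZMod g, G.Adj v (f m)} with hS
  have hfin : Finite S := inferInstance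
  haveI : Fintype S := Fintype.ofFinite S
  have hc : Fintype.card (Fin 4) ≤ Fintype.card S := by
    rw [← Nat.card_eq_fintype_card (α := S), Nat.card_coe_set_eq]
    simp; omega
  obtain ⟨e⟩ := Function.Embedding.nonempty_of_card_le hc
  have hadj : ∀ i, G.Adj x (e i).1 := fun i => (e i).2.1
  have hm : ∀ i, ∃ m : ZMod g, G.Adj (e i).1 (f m) := fun i => (e i).2.2
  choose m hm using hm
  have key : ∀ i j, i ≠ j → (m i).val ≤ (m j).val →
      g ≤ (m j).val - (m i).val + 4 ∧ (m j).val - (m i).val ≤ 4 := by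
    intro i j hij hle
    have hne : (e i).1 ≠ (e j).1 := fun h => hij (e.injective (Subtype.ext h))
    have hj := ZMod.val_lt (m j)
    have hi := ZMod.val_lt (m i)
    have h1 : m i + (((m j).val - (m i).val : ℕ) : ZMod g) = m j := by
      rw [Nat.cast_sub hle]; simp
    have b1 := arc_bound G g hg hg' f hfinj hcyc x hx1 hx2 _ _ hne (hadj i) (hadj j) (m i)
      ((m j).val - (m i).val) (by omega) (hm i) (by rw [h1]; exact hm j)
    refine ⟨b1, ?_⟩
    have h2 : m j + ((g - ((m j).val - (m i).val) : ℕ) : ZMod g) = m i := by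
      rw [Nat.cast_sub (by omega), Nat.cast_sub hle]; simp
    have b2 := arc_bound G g hg hg' f hfinj hcyc x hx1 hx2 _ _ hne.symm (hadj j) (hadj i) (m j)
      (g - ((m j).val - (m i).val)) (by omega) (hm j) (by rw [h2]; exact hm i)
    omega
  have k01 := key 0 1 (by decide)
  have k10 := key 1 0 (by decide)
  have k02 := key 0 2 (by decide)
  have k20 := key 2 0 (by decide)
  have k03 := key 0 3 (by decide)
  have k30 := key 3 0 (by decide)
  have k12 := key 1 2 (by decide)
  have k21 := key 2 1 (by decide)
  have k13 := key 1 3 (by decide)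
  have k31 := key 3 1 (by decide)
  have k23 := key 2 3 (by decide)
  have k32 := key 3 2 (by decide)
  omega
end

section
/- Let Γ = (G,σ) be a connected signed graph whose underlying graph G is triangle-free with girth g ≡ 2 or 3 (mod 4), containing a balanced shortest cycle C of length g, with i_-(Γ) = ⌈g/2⌉ + 1, and such that every vertex of Γ is at distance at most 2 from V(C). Suppose the set N_2(C) of vertices at distance exactly 2 from V(C) is a nonempty independent set containing at least two vertices. Then all vertices of N_2(C) have the same neighborhood, and this common neighborhood consists of a single vertex lying at distance 1 from V(C). -/
/-- A negative definite subspace has dimension at most the negative inertia. -/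
lemma finrank_le_negInertia {n : Type} [Fintype n] [DecidableEq n]
    {A : Matrix n n ℝ} (hA : A.IsHermitian) {E : Type} [AddCommGroup E] [Module ℝ E]
    (φ : E →ₗ[ℝ] (n → ℝ))
    (hφ : ∀ e, e ≠ 0 → Matrix.toBilin' A (φ e) (φ e) < 0) :
    Module.finrank ℝ E ≤ negInertia hA := by
  classical
  let S := {i : n // hA.eigenvalues i < 0}
  let ψ : E →ₗ[ℝ] (S → ℝ) :=
    LinearMap.pi fun i =>
      (LinearMap.proj i.1 ∘ₗ Matrix.toLin' (hA.eigenvectorUnitary : Matrix n n ℝ).conjTranspose) ∘ₗ φ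
  have hinj : Function.Injective ψ := by
    rw [← LinearMap.ker_eq_bot, LinearMap.ker_eq_bot']
    intro e he
    by_contra hne
    have h1 := hφ e hne
    have h2 : Matrix.toBilin' A (φ e) (φ e) = ∑ i, hA.eigenvalues i *
        (((hA.eigenvectorUnitary : Matrix n n ℝ).conjTranspose).mulVec (φ e) i) ^ 2 := by
      rw [Matrix.toBilin'_apply']
      conv_lhs => rw [hA.spectral_theorem]
      rw [Unitary.conjStarAlgAut_apply]
      rw [← Matrix.mulVec_mulVec, ← Matrix.mulVec_mulVec, Matrix.dotProduct_mulVec,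
        ← Matrix.mulVec_transpose]
      simp only [dotProduct, Matrix.mulVec_diagonal]
      refine Finset.sum_congr rfl fun i _ => ?_
      simp [Matrix.star_eq_conjTranspose, Matrix.conjTranspose_eq_transpose_of_trivial]
      ring
    rw [h2] at h1
    refine absurd h1 (not_lt.mpr (Finset.sum_nonneg fun i _ => ?_))
    by_cases hi : hA.eigenvalues i < 0
    · have := congrFun he ⟨i, hi⟩
      have h3 : ((hA.eigenvectorUnitary : Matrix n n ℝ).conjTranspose).mulVec (φ e) i = 0 := by
        simpa [ψ] using this
      rw [h3]; simp
    · exact mul_nonneg (not_lt.mp hi) (sq_nonneg _)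
  have h := LinearMap.finrank_le_finrank_of_injective hinj
  rw [Module.finrank_fintype_fun_eq_card, Fintype.card_subtype] at h
  exact h

/-- Adding a hyperbolic pair to a negative definite space. -/
lemma extend_neg {M E : Type} [AddCommGroup M] [Module ℝ M] [AddCommGroup E] [Module ℝ E]
    (B : LinearMap.BilinForm ℝ M) (hB : ∀ x y, B x y = B y x)
    (φ : E →ₗ[ℝ] M) (hφ : ∀ e, e ≠ 0 → B (φ e) (φ e) < 0)
    (v u : M) (hv : B v v = 0) (hvφ : ∀ e, B v (φ e) = 0) (hvu : B v u ≠ 0) :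
    ∃ φ' : (E × ℝ) →ₗ[ℝ] M, (∀ e, e ≠ 0 → B (φ' e) (φ' e) < 0) ∧
      ∀ w, B w v = 0 → B w u = 0 → (∀ e, B w (φ e) = 0) → ∀ e, B w (φ' e) = 0 := by
  let t : ℝ := -(B u u + 1) / (2 * B v u)
  let α : E →ₗ[ℝ] ℝ := (B v u)⁻¹ • (B u ∘ₗ φ)
  let φ1 : E →ₗ[ℝ] M := φ - α.smulRight v
  let φ2 : ℝ →ₗ[ℝ] M := LinearMap.toSpanSingleton ℝ M (u + t • v)
  have key : ∀ e s, φ1.coprod φ2 (e, s) = φ e - ((B v u)⁻¹ * B u (φ e)) • v + s • (u + t • v) := by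
    intro e s
    simp [φ1, φ2, α]
  refine ⟨φ1.coprod φ2, ?_, ?_⟩
  · rintro ⟨e, s⟩ hes
    have hQ : B (φ1.coprod φ2 (e, s)) (φ1.coprod φ2 (e, s)) = B (φ e) (φ e) - s ^ 2 := by
      rw [key]
      have ht : 2 * t * B v u = -(B u u + 1) := by
        simp only [t]; field_simp
      have hα : (B v u)⁻¹ * B u (φ e) * B v u = B u (φ e) := by field_simp
      simp only [map_add, map_sub, map_smul, LinearMap.add_apply, LinearMap.sub_apply,
        LinearMap.smul_apply, smul_eq_mul, hv, hvφ, hB (φ e) v, hB u v, hB (φ e) u]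
      generalize (B v u)⁻¹ * B u (φ e) = β at *
      linear_combination s ^ 2 * ht - 2 * s * hα
    rw [hQ]
    by_cases he : e = 0
    · have hs : s ≠ 0 := by
        rintro rfl; exact hes (by simp [he])
      have : 0 < s ^ 2 := by positivity
      simp [he, this]
    · have := hφ e he
      nlinarith [sq_nonneg s]
  · rintro w h1 h2 h3 ⟨e, s⟩
    rw [key]
    simp [h1, h2, h3]

lemma exists_walk {V : Type} (G : SimpleGraph V) (h : ℕ → V) (n : ℕ)
    (hadj : ∀ k < n, G.Adj (h k) (h (k + 1))) :
    ∃ p : G.Walk (h 0) (h n), p.support = (List.range (n + 1)).map h ∧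
      p.edges = (List.range n).map (fun i => s(h i, h (i + 1))) ∧ p.length = n := by
  induction n with
  | zero => exact ⟨SimpleGraph.Walk.nil, by simp, by simp, rfl⟩
  | succ n ih =>
    obtain ⟨p, h1, h2, h3⟩ := ih fun k hk => hadj k (by omega)
    refine ⟨p.concat (hadj n (by omega)), ?_, ?_, ?_⟩
    · rw [SimpleGraph.Walk.support_concat, h1, List.range_succ (n := n + 1), List.map_append]
      simp
    · rw [SimpleGraph.Walk.edges_concat, h2, List.range_succ (n := n), List.map_append]
      simp
    · rw [SimpleGraph.Walk.length_concat, h3]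

lemma girth_le_of_cycle {V : Type} (G : SimpleGraph V) (h : ℕ → V) (n : ℕ) (hn : 2 ≤ n)
    (hinj : ∀ i ≤ n, ∀ j ≤ n, h i = h j → i = j)
    (hadj : ∀ k < n, G.Adj (h k) (h (k + 1))) (hlast : G.Adj (h n) (h 0)) :
    G.girth ≤ n + 1 := by
  obtain ⟨p, h1, h2, h3⟩ := exists_walk G h n hadj
  have hc : (SimpleGraph.Walk.cons hlast p).IsCycle := by
    rw [SimpleGraph.Walk.cons_isCycle_iff]
    constructor
    · rw [SimpleGraph.Walk.isPath_def, h1]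
      refine List.Nodup.map_on ?_ List.nodup_range
      intro x hx y hy hxy
      simp only [List.mem_range] at hx hy
      exact hinj x (by omega) y (by omega) hxy
    · rw [h2]
      intro hm
      simp only [List.mem_map, List.mem_range] at hm
      obtain ⟨i, hi, he⟩ := hm
      rw [Sym2.eq_iff] at he
      rcases he with ⟨ha, _⟩ | ⟨ha, hb⟩
      · have := hinj i (by omega) n le_rfl ha; omega
      · have e1 := hinj i (by omega) 0 (by omega) ha
        have e2 := hinj (i + 1) (by omega) n le_rfl hb
        omega
  have := SimpleGraph.girth_le_length hc
  simpa [h3] using this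

lemma girth_le_four_s7 {V : Type} (G : SimpleGraph V) (v u w y : V) (hvw : v ≠ w) (huy : u ≠ y)
    (h1 : G.Adj v u) (h2 : G.Adj w u) (h3 : G.Adj w y) (h4 : G.Adj v y) : G.girth ≤ 4 := by
  have a1 := h1.ne
  have a2 := h2.ne
  have a3 := h3.ne
  have a4 := h4.ne
  refine girth_le_of_cycle G (fun i => if i = 0 then v else if i = 1 then u else
        if i = 2 then w else y) 3 (by omega) ?_ ?_ (by simpa using h4.symm)
  · intro i hi j hj hij
    have hi' : i = 0 ∨ i = 1 ∨ i = 2 ∨ i = 3 := by omega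
    have hj' : j = 0 ∨ j = 1 ∨ j = 2 ∨ j = 3 := by omega
    rcases hi' with rfl | rfl | rfl | rfl <;> rcases hj' with rfl | rfl | rfl | rfl <;>
      simp at hij ⊢ <;> first | exact absurd hij ‹_› | exact absurd hij.symm ‹_›
  · intro k hk
    have hk' : k = 0 ∨ k = 1 ∨ k = 2 := by omega
    rcases hk' with rfl | rfl | rfl
    · simpa using h1
    · simpa using h2.symm
    · simpa using h3

lemma sum_path (b : ℕ → ℕ → ℝ) (hs : ∀ k l, b k l = b l k) (hd : ∀ k, b k k = 0) (n : ℕ)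
    (h0 : ∀ k l, k + 2 ≤ l → l ≤ n → b k l = 0) :
    ∑ k ∈ Finset.range (n + 1), ∑ l ∈ Finset.range (n + 1), b k l
      = 2 * ∑ k ∈ Finset.range n, b k (k + 1) := by
  induction n with
  | zero => simp [hd]
  | succ n ih =>
    rw [Finset.sum_range_succ]
    simp_rw [Finset.sum_range_succ (fun l => b _ l) (n + 1)]
    rw [Finset.sum_add_distrib, ih fun k l h1 h2 => h0 k l h1 (by omega)]
    have e : ∑ k ∈ Finset.range (n + 1), b k (n + 1) = b n (n + 1) := by
      rw [Finset.sum_range_succ, Finset.sum_eq_zero, zero_add]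
      intro k hk
      exact h0 _ _ (by have := Finset.mem_range.mp hk; omega) le_rfl
    simp_rw [hs (n + 1) _] 
    rw [e, hd, Finset.sum_range_succ (fun k => b k (k + 1)) n]
    ring

lemma sum_cycle (b : ℕ → ℕ → ℝ) (hs : ∀ k l, b k l = b l k) (hd : ∀ k, b k k = 0) (n : ℕ)
    (hn : 1 ≤ n)
    (h0 : ∀ k l, k + 2 ≤ l → l ≤ n + 1 → ¬ (k = 0 ∧ l = n + 1) → b k l = 0) :
    ∑ k ∈ Finset.range (n + 2), ∑ l ∈ Finset.range (n + 2), b k l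
      = 2 * ∑ k ∈ Finset.range (n + 1), b k (k + 1) + 2 * b 0 (n + 1) := by
  rw [Finset.sum_range_succ]
  simp_rw [Finset.sum_range_succ (fun l => b _ l) (n + 1)]
  rw [Finset.sum_add_distrib, sum_path b hs hd n fun k l h1 h2 => h0 k l h1 (by omega) (by omega)]
  have e : ∑ k ∈ Finset.range (n + 1), b k (n + 1) = b n (n + 1) + b 0 (n + 1) := by
    rw [Finset.sum_range_succ, Finset.sum_eq_single 0]
    · ring
    · intro k hk hk0
      exact h0 _ _ (by have := Finset.mem_range.mp hk; omega) le_rfl (by omega)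
    · intro h; simp at h; omega
  simp_rw [hs (n + 1) _]
  rw [e, hd, Finset.sum_range_succ (fun k => b k (k + 1)) n]
  ring

/-- The coordinates on the (switched) cycle. -/
def tcoord (N : ℕ) (z : ℕ → ℝ) (k : ℕ) : ℝ :=
  if k % 2 = 0 then (-1) ^ (k / 2) * z (k / 2)
  else -(N : ℝ) * (-1) ^ (k / 2) * (z (k / 2) - z (k / 2 + 1))

lemma tcoord_even (N : ℕ) (z : ℕ → ℝ) (j : ℕ) : tcoord N z (2 * j) = (-1) ^ j * z j := by
  simp [tcoord]

lemma tcoord_odd (N : ℕ) (z : ℕ → ℝ) (j : ℕ) :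
    tcoord N z (2 * j + 1) = -(N : ℝ) * (-1) ^ j * (z j - z (j + 1)) := by
  have h1 : (2 * j + 1) % 2 = 1 := by omega
  have h2 : (2 * j + 1) / 2 = j := by omega
  simp [tcoord, h1, h2]

lemma tcoord_sum (N : ℕ) (z : ℕ → ℝ) (n : ℕ) :
    ∑ k ∈ Finset.range (2 * n), tcoord N z k * tcoord N z (k + 1)
      = -(N : ℝ) * ∑ j ∈ Finset.range n, (z (j + 1) - z j) ^ 2 := by
  induction n with
  | zero => simp
  | succ n ih =>
    rw [show 2 * (n + 1) = 2 * n + 1 + 1 by ring, Finset.sum_range_succ, Finset.sum_range_succ, ih,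
      Finset.sum_range_succ, show 2 * n + 1 + 1 = 2 * (n + 1) by ring, tcoord_odd, tcoord_even,
      tcoord_even]
    have : ((-1 : ℝ) ^ n) ^ 2 = 1 := by rw [← pow_mul, mul_comm, pow_mul]; simp
    rw [pow_succ]
    linear_combination (-(N : ℝ) * (z (n + 1) - z n) ^ 2) * this

lemma z_const (z : ℕ → ℝ) (N : ℕ)
    (h : ∑ j ∈ Finset.range N, (z (j + 1) - z j) ^ 2 = 0) : ∀ k ≤ N, z k = z 0 := by
  rw [Finset.sum_eq_zero_iff_of_nonneg fun _ _ => sq_nonneg _] at h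
  intro k
  induction k with
  | zero => simp
  | succ k ih =>
    intro hk
    have := h k (Finset.mem_range.mpr (by omega))
    have := pow_eq_zero_iff (two_ne_zero) |>.mp this
    rw [← ih (by omega)]; linarith

lemma tcoord_neg (g N : ℕ) (hN : 1 ≤ N) (z : ℕ → ℝ) (hz : z (N + 1) = - z 0)
    (hg : (g = 2 * N ∧ N % 2 = 1) ∨ (g = 2 * N + 1 ∧ N % 2 = 0))
    (hpos : 0 ≤ 2 * ∑ k ∈ Finset.range g, tcoord N z k * tcoord N z (k + 1)
      + 2 * (tcoord N z 0 * tcoord N z g)) :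
    ∀ k ≤ N, z k = 0 := by
  have hN' : (1 : ℝ) ≤ N := by exact_mod_cast hN
  have hD : 0 ≤ ∑ j ∈ Finset.range N, (z (j + 1) - z j) ^ 2 :=
    Finset.sum_nonneg fun _ _ => sq_nonneg _
  have h0 : tcoord N z 0 = z 0 := by simpa using tcoord_even N z 0
  have hzz := z_const z N
  have hcs : (z N - z 0) ^ 2 ≤ N * ∑ j ∈ Finset.range N, (z (j + 1) - z j) ^ 2 := by
    have := sq_sum_le_card_mul_sum_sq (s := Finset.range N) (f := fun j => z (j + 1) - z j)
    rwa [Finset.sum_range_sub, Finset.card_range] at this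
  rcases hg with ⟨rfl, ho⟩ | ⟨rfl, he⟩
  · rw [tcoord_sum, h0, tcoord_even, (Nat.odd_iff.mpr ho).neg_one_pow] at hpos
    generalize ∑ j ∈ Finset.range N, (z (j + 1) - z j) ^ 2 = D at *
    have hND : 0 ≤ (N - 1 : ℝ) * D := mul_nonneg (by linarith) hD
    have hD0 : D = 0 := by nlinarith [sq_nonneg (z 0), sq_nonneg (z N)]
    have hz0 : z 0 = 0 := by
      have : z 0 ^ 2 ≤ 0 := by nlinarith [sq_nonneg (z 0), sq_nonneg (z N)]
      exact pow_eq_zero_iff two_ne_zero |>.mp (le_antisymm this (sq_nonneg _))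
    intro k hk; rw [hzz hD0 k hk, hz0]
  · rw [Finset.sum_range_succ, tcoord_sum, h0, tcoord_even, tcoord_odd, hz,
      (Nat.even_iff.mpr he).neg_one_pow] at hpos
    generalize ∑ j ∈ Finset.range N, (z (j + 1) - z j) ^ 2 = D at *
    have hND : 0 ≤ (N - 1 : ℝ) * D := mul_nonneg (by linarith) hD
    have hNS : 0 ≤ (N - 1 : ℝ) * (z 0 + z N) ^ 2 := mul_nonneg (by linarith) (sq_nonneg _)
    have hD0 : D = 0 := by nlinarith [sq_nonneg (z 0 + z N)]
    have hz0 : (z 0 + z N) ^ 2 ≤ 0 := by nlinarith [sq_nonneg (z 0 + z N)]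
    have hz0 := pow_eq_zero_iff two_ne_zero |>.mp (le_antisymm hz0 (sq_nonneg _))
    rw [hzz hD0 N le_rfl] at hz0
    intro k hk; rw [hzz hD0 k hk]; linarith

/-- Extension of `z : Fin (N+1) → ℝ` to `ℕ`, as a linear map. -/
def zext (N : ℕ) : (Fin (N + 1) → ℝ) →ₗ[ℝ] (ℕ → ℝ) where
  toFun z k := if h : k < N + 1 then z ⟨k, h⟩ else - z 0
  map_add' x y := by
    ext k; by_cases h : k < N + 1 <;> simp only [h, dite_true, dite_false, Pi.add_apply]; ring
  map_smul' c x := by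
    ext k; by_cases h : k < N + 1 <;> simp [h, -Order.lt_add_one_iff]

/-- `tcoord` as a linear map. -/
def tlin (N : ℕ) : (ℕ → ℝ) →ₗ[ℝ] (ℕ → ℝ) where
  toFun z := tcoord N z
  map_add' x y := by
    ext k; by_cases h : k % 2 = 0 <;> simp [tcoord, h] <;> ring
  map_smul' c x := by
    ext k; by_cases h : k % 2 = 0 <;> simp [tcoord, h] <;> ring

/-- The vector supported on the vertices `h 0, …, h (g-1)` with coefficients `s k * x k`. -/
noncomputable def cvec {V : Type} [DecidableEq V] (h : ℕ → V) (s : ℕ → ℝ) (g : ℕ) :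
    (ℕ → ℝ) →ₗ[ℝ] (V → ℝ) :=
  ∑ k ∈ Finset.range g, (s k • LinearMap.proj k).smulRight (Pi.single (h k) (1 : ℝ))

lemma cvec_apply {V : Type} [DecidableEq V] (h : ℕ → V) (s : ℕ → ℝ) (g : ℕ) (x : ℕ → ℝ) :
    cvec h s g x = ∑ k ∈ Finset.range g, (s k * x k) • Pi.single (h k) (1 : ℝ) := by
  simp [cvec]

/-- Negative definite space on a balanced chordless cycle. -/
lemma cycle_neg {V : Type} [Fintype V] [DecidableEq V] (A : Matrix V V ℝ)
    (hsym : ∀ u v, A u v = A v u) (hdiag : ∀ u, A u u = 0) (h : ℕ → V) (n N : ℕ)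
    (hN : 1 ≤ N)
    (hg : (n + 1 = 2 * N ∧ N % 2 = 1) ∨ (n + 1 = 2 * N + 1 ∧ N % 2 = 0))
    (hpm : ∀ k, A (h k) (h (k + 1)) = 1 ∨ A (h k) (h (k + 1)) = -1)
    (hper : h (n + 2) = h 0)
    (hbal : ∏ k ∈ Finset.range (n + 2), A (h k) (h (k + 1)) = 1)
    (hch : ∀ k l, k + 2 ≤ l → l ≤ n + 1 → ¬ (k = 0 ∧ l = n + 1) → A (h k) (h l) = 0) :
    ∃ φ : (Fin (N + 1) → ℝ) →ₗ[ℝ] (V → ℝ),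
      (∀ e, e ≠ 0 → Matrix.toBilin' A (φ e) (φ e) < 0) ∧
      ∀ v, (∀ k, A v (h k) = 0) → ∀ e, Matrix.toBilin' A (Pi.single v 1) (φ e) = 0 := by
  let s : ℕ → ℝ := fun k => ∏ i ∈ Finset.range k, A (h i) (h (i + 1))
  have hsq : ∀ k, A (h k) (h (k + 1)) ^ 2 = 1 := fun k => by
    rcases hpm k with e | e <;> simp [e]
  have hs1 : ∀ k, s (k + 1) = s k * A (h k) (h (k + 1)) := fun k => Finset.prod_range_succ _ _
  have hs2 : ∀ k, s k ^ 2 = 1 := by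
    intro k
    induction k with
    | zero => simp [s]
    | succ k ih => rw [hs1, mul_pow, ih, hsq, one_mul]
  refine ⟨cvec h s (n + 2) ∘ₗ tlin N ∘ₗ zext N, ?_, ?_⟩
  · intro e he
    by_contra hcon
    apply he
    set z := zext N e with hz
    have hQ : Matrix.toBilin' A (cvec h s (n + 2) (tcoord N z)) (cvec h s (n + 2) (tcoord N z))
        = 2 * ∑ k ∈ Finset.range (n + 1), tcoord N z k * tcoord N z (k + 1)
      + 2 * (tcoord N z 0 * tcoord N z (n + 1)) := by
      rw [cvec_apply]
      simp only [map_sum, map_smul, LinearMap.sum_apply, LinearMap.smul_apply, smul_eq_mul,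
        Matrix.toBilin'_single]
      have := sum_cycle (fun k l => s k * tcoord N z k * (s l * tcoord N z l * A (h k) (h l)))
        (fun k l => by rw [hsym]; ring) (fun k => by simp [hdiag]) n (by omega)
        (fun k l h1 h2 h3 => by simp [hch k l h1 h2 h3])
      simp_rw [Finset.mul_sum]
      have hsw : ∀ k l, s k * tcoord N z k * (s l * tcoord N z l * A (h l) (h k))
          = s k * tcoord N z k * (s l * tcoord N z l * A (h k) (h l)) := by
        intro k l; rw [hsym (h l) (h k)]
      simp_rw [hsw]
      refine this.trans ?_
      have e1 : s 0 = 1 := by simp [s]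
      have e2 : s (n + 1) * A (h (n + 1)) (h 0) = 1 := by
        rw [← hper, ← hs1]; exact hbal
      have c1 : ∀ k, s k * tcoord N z k * (s (k + 1) * tcoord N z (k + 1) * A (h k) (h (k + 1)))
          = tcoord N z k * tcoord N z (k + 1) := by
        intro k
        rw [hs1]
        linear_combination (tcoord N z k * tcoord N z (k + 1)) *
          ((A (h k) (h (k + 1))) ^ 2 * hs2 k + hsq k)
      simp_rw [c1, Finset.mul_sum]
      rw [e1, hsym (h 0)]
      linear_combination (2 * tcoord N z 0 * tcoord N z (n + 1)) * e2
    have hzz := tcoord_neg (n + 1) N hN z (by simp [hz, zext]) hg (by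
      rw [← hQ]; exact not_lt.mp hcon)
    ext i
    have := hzz i (by omega)
    simpa [hz, zext, show (i : ℕ) ≤ N by omega] using this
  · intro v hv e
    simp only [LinearMap.comp_apply, cvec_apply, map_sum, map_smul, Matrix.toBilin'_single, hv]
    simp

/-- For a connected triangle-free signed graph `Γ` (adjacency matrix `A`
over the underlying graph `G`) with girth `g ≡ 2, 3 (mod 4)`, containing a balanced
shortest cycle parametrized by `f : ZMod g → V`, with `i₋(Γ) = ⌈g/2⌉ + 1` and every
vertex at distance at most `2` from the cycle: if the set `N₂` of vertices at distance
exactly `2` is an independent set with at least two vertices, then all vertices of `N₂`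
have the same neighbourhood, consisting of a single vertex at distance `1` from the
cycle. -/
theorem stmt_7 {V : Type} [Fintype V] [DecidableEq V]
    (G : SimpleGraph V) (hconn : G.Connected) (htf : G.CliqueFree 3)
    (A : Matrix V V ℝ) (hA : A.IsHermitian)
    (hone : ∀ u v, G.Adj u v → A u v = 1 ∨ A u v = -1)
    (hzero : ∀ u v, ¬ G.Adj u v → A u v = 0)
    (g : ℕ) (hgirth : G.girth = (g : ℕ∞)) (hmod : g % 4 = 2 ∨ g % 4 = 3)
    (f : ZMod g → V) (hfinj : Function.Injective f)
    (hcyc : ∀ m : ZMod g, G.Adj (f m) (f (m + 1)))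
    (hbal : ∏ i : Fin g, A (f (((i : ℕ) : ZMod g))) (f (((i : ℕ) : ZMod g) + 1)) = 1)
    (hneg : negInertia hA = (g + 1) / 2 + 1)
    (hle : ∀ v : V, distToCycle G f v ≤ 2)
    (hindep : ∀ v w : V, distToCycle G f v = 2 → distToCycle G f w = 2 → ¬ G.Adj v w)
    (htwo : ∃ v w : V, v ≠ w ∧ distToCycle G f v = 2 ∧ distToCycle G f w = 2) :
    ∃ u : V, distToCycle G f u = 1 ∧
      ∀ v : V, distToCycle G f v = 2 → ∀ w : V, (G.Adj v w ↔ w = u) := by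
  classical
  have hg' : G.girth = g := by exact_mod_cast hgirth
  have hnac : ¬ G.IsAcyclic := by
    intro h
    have := SimpleGraph.girth_eq_zero.mpr h
    omega
  have h3 : 3 ≤ g := by
    have := SimpleGraph.three_le_girth hnac
    omega
  have hsym : ∀ u v, A u v = A v u := fun u v => by
    simpa using (hA.apply u v).symm
  have hne3 : g ≠ 3 := by
    rintro rfl
    have e1 := hcyc 0
    have e2 := hcyc 1
    have e3 := hcyc 2
    have t1 : (0 + 1 : ZMod 3) = 1 := by decide
    have t2 : (1 + 1 : ZMod 3) = 2 := by decide
    have t3 : (2 + 1 : ZMod 3) = 0 := by decide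
    rw [t1] at e1
    rw [t2] at e2
    rw [t3] at e3
    exact htf {f 0, f 1, f 2} (SimpleGraph.is3Clique_triple_iff.mpr ⟨e1, e3.symm, e2⟩)
  obtain ⟨n, rfl⟩ : ∃ n, g = n + 2 := ⟨g - 2, by omega⟩
  let h : ℕ → V := fun k => f (k : ZMod (n + 2))
  have hinj : ∀ i < n + 2, ∀ j < n + 2, h i = h j → i = j := by
    intro i hi j hj hij
    have := hfinj hij
    rw [ZMod.natCast_eq_natCast_iff'] at this
    rwa [Nat.mod_eq_of_lt hi, Nat.mod_eq_of_lt hj] at this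
  have hadj : ∀ k, G.Adj (h k) (h (k + 1)) := fun k => by
    simpa [h] using hcyc (k : ZMod (n + 2))
  have hper : h (n + 2) = h 0 := by
    have : ((n + 2 : ℕ) : ZMod (n + 2)) = 0 := ZMod.natCast_self _
    simp only [h, this]; simp
  have hsurj : ∀ m, ∃ k, h k = f m := fun m => ⟨m.val, by simp [h]⟩
  -- distance facts
  have hD : ∀ v m, distToCycle G f v ≤ G.dist v (f m) := fun v m => Nat.sInf_le ⟨m, rfl⟩
  have hDon : ∀ v m, distToCycle G f v = 2 → v ≠ f m := by
    rintro v m hv rfl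
    have := hD (f m) m
    simp at this; omega
  have hDadj : ∀ v m, distToCycle G f v = 2 → ¬ G.Adj v (f m) := by
    intro v m hv ha
    have := hD v m
    rw [SimpleGraph.dist_eq_one_iff_adj.mpr ha] at this
    omega
  have hDnb : ∀ v u, distToCycle G f v = 2 → G.Adj v u → distToCycle G f u = 1 := by
    intro v u hv ha
    have h1 := hle u
    have h2 : distToCycle G f u ≠ 2 := fun h => hindep v u hv h ha
    have h0 : distToCycle G f u ≠ 0 := by
      intro h0
      have hm : distToCycle G f u ∈ {d : ℕ | ∃ m : ZMod (n + 2), G.dist u (f m) = d} :=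
        Nat.sInf_mem ⟨_, 0, rfl⟩
      obtain ⟨m, hm⟩ := hm
      rw [h0, hconn.dist_eq_zero_iff] at hm
      exact hDadj v m hv (hm ▸ ha)
    omega
  have hex : ∀ v, distToCycle G f v = 2 → ∃ u, G.Adj v u := by
    intro v hv
    obtain ⟨p⟩ := hconn.preconnected v (f 0)
    cases p with
    | nil => exact absurd rfl (hDon _ 0 hv)
    | cons ha _ => exact ⟨_, ha⟩
  have hdiag : ∀ u, A u u = 0 := fun u => hzero u u (G.irrefl)
  -- cycle part
  have hch : ∀ k l, k + 2 ≤ l → l ≤ n + 1 → ¬ (k = 0 ∧ l = n + 1) → A (h k) (h l) = 0 := by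
    intro k l h1 h2 h3
    apply hzero
    intro ha
    have := girth_le_of_cycle G (fun i => h (k + i)) (l - k) (by omega)
      (fun i hi j hj hij => by
        have := hinj (k + i) (by omega) (k + j) (by omega) hij
        omega) (fun i _ => hadj (k + i)) (by
        have e : k + (l - k) = l := by omega
        simpa [e] using ha.symm)
    omega
  obtain ⟨φ, hφ, hφo⟩ := cycle_neg A hsym hdiag h n ((n + 1) / 2) (by omega) (by omega)
    (fun k => hone _ _ (hadj k)) hper (by
      rw [Finset.prod_range, ← hbal]
      simp [h]) hch
  have hBs : ∀ x y, Matrix.toBilin' A x y = Matrix.toBilin' A y x := by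
    intro x y
    simp only [Matrix.toBilin'_apply]
    rw [Finset.sum_comm]
    refine Finset.sum_congr rfl fun i _ => Finset.sum_congr rfl fun j _ => ?_
    rw [hsym]; ring
  have hoff : ∀ v, distToCycle G f v = 2 → ∀ k, A v (h k) = 0 := fun v hv k =>
    hzero _ _ (hDadj v _ hv)
  have hnz : ∀ u v, G.Adj u v → A u v ≠ 0 := by
    intro u v ha
    rcases hone u v ha with e | e <;> simp [e]
  have key : ∀ v w u, distToCycle G f v = 2 → distToCycle G f w = 2 → G.Adj v u → G.Adj w u := by
    intro v w u hv hw hvu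
    by_contra hwu
    obtain ⟨u', hwu'⟩ := hex w hw
    obtain ⟨φ1, hφ1, hφ1o⟩ := extend_neg (Matrix.toBilin' A) hBs φ hφ (Pi.single v 1)
      (Pi.single u 1) (by simp [Matrix.toBilin'_single, hdiag]) (hφo v (hoff v hv))
      (by rw [Matrix.toBilin'_single]; exact hnz _ _ hvu)
    obtain ⟨φ2, hφ2, -⟩ := extend_neg (Matrix.toBilin' A) hBs φ1 hφ1 (Pi.single w 1)
      (Pi.single u' 1) (by simp [Matrix.toBilin'_single, hdiag])
      (hφ1o _ (by rw [Matrix.toBilin'_single]; exact hzero _ _ (hindep w v hw hv))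
        (by rw [Matrix.toBilin'_single]; exact hzero _ _ hwu) (hφo w (hoff w hw)))
      (by rw [Matrix.toBilin'_single]; exact hnz _ _ hwu')
    have := finrank_le_negInertia hA φ2 hφ2
    simp at this
    omega
  obtain ⟨v, w, hvw, hv, hw⟩ := htwo
  obtain ⟨u, hu⟩ := hex v hv
  refine ⟨u, hDnb v u hv hu, ?_⟩
  intro x hx y
  constructor
  · intro hxy
    by_contra hyu
    have e1 := key x v y hx hv hxy
    have e2 := key x w y hx hw hxy
    have e3 := key v w u hv hw hu
    have := girth_le_four_s7 G v u w y hvw (Ne.symm hyu) hu e3 e2 e1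
    omega
  · rintro rfl
    exact key v x y hv hx hu
end
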